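/- arXiv:1810.03326 — 3 statements merged into one kernel-verified Lean document; each statement's English description precedes it below -/
import Mathlib

section
/- Let f ∈ L¹([-π,π]) be real-valued with Fourier coefficients a_k = (1/2π)∫_{-π}^{π} f(θ)e^{-ikθ}dθ, and let T_n[f] be the n×n Toeplitz matrix with (s,t) entry a_{s-t} (which is Hermitian for every n). Then {T_n[f]}_n has asymptotic eigenvalue distribution described by f, i.e. for every continuous function F: ℂ → ℂ with compact support, lim_{n→∞} (1/n)∑_{j=1}^{n} F(λ_j(T_n[f])) = (1/2π)∫_{-π}^{π} F(f(θ))dθ. -/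
open MeasureTheory Filter Matrix

section FejerJensen

open AddCircle InnerProductSpace

variable {T : ℝ}

/-- The vector whose coordinates are the conjugates of the first `n` Fourier monomials at `x`. -/
noncomputable def waveVector (n : ℕ) (x : AddCircle T) : EuclideanSpace ℂ (Fin n) :=
  WithLp.toLp 2 fun s => fourier (-(s : ℤ)) x

lemma norm_fourier_apply (k : ℤ) (x : AddCircle T) : ‖fourier k x‖ = 1 := by
  rw [fourier_apply, Circle.norm_coe]

lemma norm_sq_waveVector (n : ℕ) (x : AddCircle T) : ‖waveVector n x‖ ^ 2 = n := by
  rw [EuclideanSpace.norm_sq_eq]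
  simp only [waveVector, norm_fourier_apply]
  simp

lemma continuous_waveVector (n : ℕ) : Continuous (waveVector (T := T) n) := by
  unfold waveVector
  refine (PiLp.continuous_toLp 2 _).comp (continuous_pi fun s => ?_)
  exact map_continuous (fourier _)

lemma continuous_norm_sq_inner_waveVector {n : ℕ} (v : EuclideanSpace ℂ (Fin n)) :
    Continuous fun x : AddCircle T => ‖⟪waveVector n x, v⟫_ℂ‖ ^ 2 :=
  (((continuous_waveVector n).inner continuous_const).norm).pow 2

lemma norm_sq_inner_waveVector_eq_sum {n : ℕ} (v : EuclideanSpace ℂ (Fin n)) (x : AddCircle T) :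
    ((‖⟪waveVector n x, v⟫_ℂ‖ ^ 2 : ℝ) : ℂ) =
      ∑ s : Fin n, ∑ t : Fin n, star (v s) * fourier (-((s : ℤ) - (t : ℤ))) x * v t := by
  have h : ⟪waveVector n x, v⟫_ℂ = ∑ t : Fin n, v t * fourier (t : ℤ) x := by
    rw [EuclideanSpace.inner_eq_star_dotProduct]
    simp only [waveVector, dotProduct, Pi.star_apply, fourier_neg, RCLike.star_def,
      Complex.conj_conj]
  have h2 : ((‖⟪waveVector n x, v⟫_ℂ‖ ^ 2 : ℝ) : ℂ) =
      star ⟪waveVector n x, v⟫_ℂ * ⟪waveVector n x, v⟫_ℂ := by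
    rw [RCLike.star_def, Complex.conj_mul', Complex.ofReal_pow]
  rw [h2, h, star_sum, Finset.sum_mul_sum]
  refine Finset.sum_congr rfl fun s _ => Finset.sum_congr rfl fun t _ => ?_
  rw [neg_sub, sub_eq_neg_add, fourier_add, fourier_neg, star_mul', RCLike.star_def]
  ring

variable [hT : Fact (0 < T)]

/-- The Toeplitz matrix of size `n` with symbol `f`. -/
noncomputable def fourierToeplitz (f : AddCircle T → ℂ) (n : ℕ) : Matrix (Fin n) (Fin n) ℂ :=
  Matrix.of fun s t => fourierCoeff f ((s : ℤ) - (t : ℤ))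

/-- The `n`-th Fejér mean of `f`, written as a Rayleigh quotient of the Toeplitz matrix. -/
noncomputable def fejerMean (n : ℕ) (f : AddCircle T → ℂ) (x : AddCircle T) : ℂ :=
  (n : ℂ)⁻¹ * ⟪waveVector n x, (fourierToeplitz f n).toEuclideanLin (waveVector n x)⟫_ℂ

lemma integrable_mul_norm_sq_inner_waveVector {n : ℕ} {f : AddCircle T → ℝ}
    (hf : Integrable f haarAddCircle) (v : EuclideanSpace ℂ (Fin n)) :
    Integrable (fun x => f x * ‖⟪waveVector n x, v⟫_ℂ‖ ^ 2) haarAddCircle := by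
  obtain ⟨C, hC⟩ := isCompact_univ.exists_bound_of_continuousOn
    (continuous_norm_sq_inner_waveVector (T := T) v).continuousOn
  exact hf.mul_bdd (continuous_norm_sq_inner_waveVector v).aestronglyMeasurable
    (ae_of_all _ fun x => hC x (Set.mem_univ x))

lemma integrable_norm_sq_inner_waveVector {n : ℕ} (v : EuclideanSpace ℂ (Fin n)) :
    Integrable (fun x : AddCircle T => ‖⟪waveVector n x, v⟫_ℂ‖ ^ 2) haarAddCircle := by
  simpa using integrable_mul_norm_sq_inner_waveVector
    (integrable_const (1 : ℝ) : Integrable (fun _ : AddCircle T => (1 : ℝ)) haarAddCircle) v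

lemma inner_toEuclideanLin_eq_sum {n : ℕ} (A : Matrix (Fin n) (Fin n) ℂ)
    (v w : EuclideanSpace ℂ (Fin n)) :
    ⟪v, A.toEuclideanLin w⟫_ℂ = ∑ s, ∑ t, star (v s) * A s t * w t := by
  rw [EuclideanSpace.inner_eq_star_dotProduct]
  simp only [Matrix.ofLp_toLpLin, Matrix.toLin'_apply, dotProduct, mulVec, Pi.star_apply,
    Finset.sum_mul]
  exact Finset.sum_congr rfl fun s _ => Finset.sum_congr rfl fun t _ => by ring

/-- The quadratic form of a Toeplitz matrix is an average of its symbol. -/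
lemma inner_fourierToeplitz {n : ℕ} {f : AddCircle T → ℂ} (hf : Integrable f haarAddCircle)
    (v : EuclideanSpace ℂ (Fin n)) :
    ⟪v, (fourierToeplitz f n).toEuclideanLin v⟫_ℂ =
      ∫ x, f x * ((‖⟪waveVector n x, v⟫_ℂ‖ ^ 2 : ℝ) : ℂ) ∂haarAddCircle := by
  have h : ∀ x, f x * ((‖⟪waveVector n x, v⟫_ℂ‖ ^ 2 : ℝ) : ℂ) =
      ∑ s : Fin n, ∑ t : Fin n, star (v s) * v t * (fourier (-((s : ℤ) - (t : ℤ))) x • f x) := fun x => by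
    rw [norm_sq_inner_waveVector_eq_sum, Finset.mul_sum]
    refine Finset.sum_congr rfl fun s _ => ?_
    rw [Finset.mul_sum]
    exact Finset.sum_congr rfl fun t _ => by rw [smul_eq_mul]; ring
  have hi : ∀ s t : Fin n, Integrable (fun x => star (v s) * v t *
      (fourier (-((s : ℤ) - (t : ℤ))) x • f x)) haarAddCircle :=
    fun s t => (hf.fourier_smul _).const_mul _
  simp_rw [h]
  rw [inner_toEuclideanLin_eq_sum, integral_finsetSum _ fun s _ => integrable_finsetSum _
    fun t _ => hi s t]
  refine Finset.sum_congr rfl fun s _ => ?_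
  rw [integral_finsetSum _ fun t _ => hi s t]
  refine Finset.sum_congr rfl fun t _ => ?_
  rw [integral_const_mul]
  simp only [fourierToeplitz, Matrix.of_apply, fourierCoeff]
  ring

lemma inner_fourierToeplitz_ofReal {n : ℕ} {f : AddCircle T → ℝ}
    (hf : Integrable f haarAddCircle) (v : EuclideanSpace ℂ (Fin n)) :
    ⟪v, (fourierToeplitz (fun x => (f x : ℂ)) n).toEuclideanLin v⟫_ℂ =
      ((∫ x, f x * ‖⟪waveVector n x, v⟫_ℂ‖ ^ 2 ∂haarAddCircle : ℝ) : ℂ) := by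
  rw [inner_fourierToeplitz (f := fun x => (f x : ℂ)) hf.ofReal, ← integral_complex_ofReal]
  simp only [Complex.ofReal_mul]

lemma fourierToeplitz_one (n : ℕ) :
    fourierToeplitz (fun _ : AddCircle T => ((1 : ℝ) : ℂ)) n = 1 := by
  have h : (fun _ : AddCircle T => ((1 : ℝ) : ℂ)) = fourier 0 := by ext; simp
  ext s t
  rw [fourierToeplitz, Matrix.of_apply, h, fourierCoeff_fourier, Matrix.one_apply, Pi.single_apply]
  simp [sub_eq_zero, Fin.ext_iff]

lemma integral_norm_sq_inner_waveVector {n : ℕ} (v : EuclideanSpace ℂ (Fin n)) :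
    ∫ x : AddCircle T, ‖⟪waveVector n x, v⟫_ℂ‖ ^ 2 ∂haarAddCircle = ‖v‖ ^ 2 := by
  have h := inner_fourierToeplitz_ofReal
    (integrable_const (1 : ℝ) : Integrable (fun _ : AddCircle T => (1 : ℝ)) haarAddCircle) v
  rw [fourierToeplitz_one, Matrix.toLpLin_one] at h
  simp only [LinearMap.id_apply, one_mul, inner_self_eq_norm_sq_to_K] at h
  exact Complex.ofReal_injective (h.symm.trans (Complex.ofReal_pow _ _).symm)

lemma isHermitian_fourierToeplitz (f : AddCircle T → ℝ) (n : ℕ) :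
    (fourierToeplitz (fun x => (f x : ℂ)) n).IsHermitian := by
  ext s t
  simp only [fourierToeplitz, Matrix.conjTranspose_apply, Matrix.of_apply, fourierCoeff,
    RCLike.star_def]
  rw [← integral_conj]
  congr 1
  ext x
  rw [smul_eq_mul, map_mul, ← fourier_neg, Complex.conj_ofReal, smul_eq_mul]
  congr 3
  ring

lemma Matrix.IsHermitian.inner_toEuclideanLin_eq_sum {n : ℕ}
    {A : Matrix (Fin n) (Fin n) ℂ} (hA : A.IsHermitian) (w : EuclideanSpace ℂ (Fin n)) :
    ⟪w, A.toEuclideanLin w⟫_ℂ =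
      ((∑ j, hA.eigenvalues j * ‖⟪w, hA.eigenvectorBasis j⟫_ℂ‖ ^ 2 : ℝ) : ℂ) := by
  have hv : ∀ j, A.toEuclideanLin (hA.eigenvectorBasis j) =
      (hA.eigenvalues j : ℂ) • hA.eigenvectorBasis j := fun j => by
    rw [Matrix.toLpLin_apply, hA.mulVec_eigenvectorBasis]
    rfl
  rw [← hA.eigenvectorBasis.sum_inner_mul_inner, Complex.ofReal_sum]
  refine Finset.sum_congr rfl fun j _ => ?_
  rw [← (Matrix.isSymmetric_toEuclideanLin_iff.mpr hA) (hA.eigenvectorBasis j) w, hv,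
    inner_smul_left, Complex.conj_ofReal, Complex.ofReal_mul, Complex.ofReal_pow,
    ← Complex.mul_conj', inner_conj_symm]
  ring

lemma Matrix.IsHermitian.inner_eigenvectorBasis {n : ℕ}
    {A : Matrix (Fin n) (Fin n) ℂ} (hA : A.IsHermitian) (j : Fin n) :
    ⟪hA.eigenvectorBasis j, A.toEuclideanLin (hA.eigenvectorBasis j)⟫_ℂ = hA.eigenvalues j := by
  rw [Matrix.toLpLin_apply, hA.mulVec_eigenvectorBasis]
  change ⟪_, (hA.eigenvalues j : ℂ) • hA.eigenvectorBasis j⟫_ℂ = _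
  rw [inner_smul_right, inner_self_eq_norm_sq_to_K, hA.eigenvectorBasis.orthonormal.1 j]
  simp

lemma sum_abs_eigenvalues_sub_le {f : AddCircle T → ℝ} (hf : Integrable f haarAddCircle) {n : ℕ}
    (hA : (fourierToeplitz (fun x => (f x : ℂ)) n).IsHermitian) (c : ℝ) :
    ∑ j, |hA.eigenvalues j - c| ≤ n * ∫ x, |f x - c| ∂haarAddCircle := by
  have hfc : Integrable (fun x => f x - c) haarAddCircle := hf.sub (integrable_const c)
  have h : ∀ j, |hA.eigenvalues j - c| ≤
      ∫ x, |f x - c| * ‖⟪waveVector n x, hA.eigenvectorBasis j⟫_ℂ‖ ^ 2 ∂haarAddCircle := by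
    intro j
    have h1 : hA.eigenvalues j - c =
        ∫ x, (f x - c) * ‖⟪waveVector n x, hA.eigenvectorBasis j⟫_ℂ‖ ^ 2 ∂haarAddCircle := by
      simp only [sub_mul]
      rw [integral_sub (integrable_mul_norm_sq_inner_waveVector hf _)
        ((integrable_norm_sq_inner_waveVector _).const_mul c), integral_const_mul,
        integral_norm_sq_inner_waveVector, hA.eigenvectorBasis.orthonormal.1 j, one_pow, mul_one]
      congr 1
      exact_mod_cast (hA.inner_eigenvectorBasis j).symm.trans (inner_fourierToeplitz_ofReal hf _)
    rw [h1]
    refine abs_integral_le_integral_abs.trans (le_of_eq ?_)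
    simp only [abs_mul, abs_of_nonneg (sq_nonneg ‖_‖)]
  refine (Finset.sum_le_sum fun j _ => h j).trans (le_of_eq ?_)
  rw [← integral_finsetSum _ fun j _ => integrable_mul_norm_sq_inner_waveVector hfc.abs _,
    ← integral_const_mul]
  congr 1
  ext x
  rw [← Finset.mul_sum, hA.eigenvectorBasis.sum_sq_norm_inner_left, norm_sq_waveVector, mul_comm]

lemma continuous_fejerMean (n : ℕ) (f : AddCircle T → ℂ) : Continuous (fejerMean n f) :=
  continuous_const.mul ((continuous_waveVector n).inner
    ((LinearMap.continuous_of_finiteDimensional _).comp (continuous_waveVector n)))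

lemma integrable_of_continuous {E : Type*} [NormedAddCommGroup E] {g : AddCircle T → E}
    (hg : Continuous g) : Integrable g haarAddCircle :=
  integrableOn_univ.1 (hg.continuousOn.integrableOn_compact isCompact_univ)

lemma integral_norm_fejerMean_sub_le {f : AddCircle T → ℝ} {n : ℕ} (hn : n ≠ 0)
    (hA : (fourierToeplitz (fun x => (f x : ℂ)) n).IsHermitian) (c : ℝ) :
    ∫ x, ‖fejerMean n (fun x => (f x : ℂ)) x - c‖ ∂haarAddCircle ≤
      (n : ℝ)⁻¹ * ∑ j, |hA.eigenvalues j - c| := by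
  have hn' : (n : ℝ) ≠ 0 := Nat.cast_ne_zero.2 hn
  have h : ∀ x, ‖fejerMean n (fun x => (f x : ℂ)) x - c‖ ≤ (n : ℝ)⁻¹ *
      ∑ j, |hA.eigenvalues j - c| * ‖⟪waveVector n x, hA.eigenvectorBasis j⟫_ℂ‖ ^ 2 := by
    intro x
    have h1 : fejerMean n (fun x => (f x : ℂ)) x - c = (((n : ℝ)⁻¹ * ∑ j, (hA.eigenvalues j - c) *
        ‖⟪waveVector n x, hA.eigenvectorBasis j⟫_ℂ‖ ^ 2 : ℝ) : ℂ) := by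
      simp only [sub_mul, Finset.sum_sub_distrib]
      rw [← Finset.mul_sum, hA.eigenvectorBasis.sum_sq_norm_inner_left, norm_sq_waveVector,
        fejerMean, hA.inner_toEuclideanLin_eq_sum, mul_sub, mul_comm c, inv_mul_cancel_left₀ hn']
      push_cast
      rfl
    rw [h1, Complex.norm_real, Real.norm_eq_abs, abs_mul, abs_of_nonneg (by positivity)]
    gcongr
    refine (Finset.abs_sum_le_sum_abs _ _).trans (le_of_eq ?_)
    simp only [abs_mul, abs_of_nonneg (sq_nonneg ‖_‖)]
  have hi : ∀ j, Integrable (fun x : AddCircle T => |hA.eigenvalues j - c| *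
      ‖⟪waveVector n x, hA.eigenvectorBasis j⟫_ℂ‖ ^ 2) haarAddCircle :=
    fun j => (integrable_norm_sq_inner_waveVector _).const_mul _
  refine (integral_mono (integrable_of_continuous
    ((continuous_fejerMean n _).sub continuous_const).norm)
    ((integrable_finsetSum _ fun j _ => hi j).const_mul _) h).trans (le_of_eq ?_)
  rw [integral_const_mul, integral_finsetSum _ fun j _ => hi j]
  congr 1
  refine Finset.sum_congr rfl fun j _ => ?_
  rw [integral_const_mul, integral_norm_sq_inner_waveVector,
    hA.eigenvectorBasis.orthonormal.1 j, one_pow, mul_one]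

lemma fejerMean_eq_sum (n : ℕ) (f : AddCircle T → ℂ) (x : AddCircle T) :
    fejerMean n f x = (n : ℂ)⁻¹ * ∑ s : Fin n, ∑ t : Fin n,
      fourierCoeff f ((s : ℤ) - (t : ℤ)) * fourier ((s : ℤ) - (t : ℤ)) x := by
  rw [fejerMean, inner_toEuclideanLin_eq_sum]
  congr 1
  refine Finset.sum_congr rfl fun s _ => Finset.sum_congr rfl fun t _ => ?_
  simp only [waveVector, fourierToeplitz, Matrix.of_apply]
  rw [fourier_neg, RCLike.star_def, Complex.conj_conj, sub_eq_add_neg, fourier_add]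
  ring

lemma fejerMean_sub (n : ℕ) {f g : AddCircle T → ℂ} (hf : Integrable f haarAddCircle)
    (hg : Integrable g haarAddCircle) (x : AddCircle T) :
    fejerMean n (f - g) x = fejerMean n f x - fejerMean n g x := by
  have h : fourierCoeff (f - g) = fourierCoeff f - fourierCoeff g := by
    have h1 := fourierCoeff.add (hf.sub hg) hg
    rw [sub_add_cancel] at h1
    rw [h1, add_sub_cancel_right]
  simp only [fejerMean_eq_sum, h, Pi.sub_apply, sub_mul, Finset.sum_sub_distrib, mul_sub]

lemma fejerMean_add (n : ℕ) {f g : AddCircle T → ℂ} (hf : Integrable f haarAddCircle)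
    (hg : Integrable g haarAddCircle) (x : AddCircle T) :
    fejerMean n (f + g) x = fejerMean n f x + fejerMean n g x := by
  simp only [fejerMean_eq_sum, fourierCoeff.add hf hg, Pi.add_apply, add_mul,
    Finset.sum_add_distrib, mul_add]

lemma fejerMean_const_smul (n : ℕ) (c : ℂ) (f : AddCircle T → ℂ) (x : AddCircle T) :
    fejerMean n (c • f) x = c * fejerMean n f x := by
  simp only [fejerMean_eq_sum, fourierCoeff.const_smul, smul_eq_mul, mul_assoc,
    ← Finset.mul_sum]
  ring

lemma integral_fourier (k : ℤ) :
    ∫ x : AddCircle T, fourier k x ∂haarAddCircle = if k = 0 then 1 else 0 := by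
  have h := congrFun (fourierCoeff_fourier (T := T) k) 0
  rw [Pi.single_apply] at h
  simpa [fourierCoeff, -fourier_apply, fourier_zero, eq_comm] using h

lemma integral_fejerMean {n : ℕ} (hn : n ≠ 0) (f : AddCircle T → ℂ) :
    ∫ x, fejerMean n f x ∂haarAddCircle = ∫ x, f x ∂haarAddCircle := by
  have hi : ∀ s t : Fin n, Integrable (fun x : AddCircle T =>
      fourierCoeff f ((s : ℤ) - (t : ℤ)) * fourier ((s : ℤ) - (t : ℤ)) x) haarAddCircle :=
    fun s t => (integrable_of_continuous (map_continuous (fourier _))).const_mul _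
  have h0 : fourierCoeff f 0 = ∫ x, f x ∂haarAddCircle := by
    simp [fourierCoeff, -fourier_apply, fourier_zero]
  have hs : ∀ s : Fin n, ∑ t : Fin n, fourierCoeff f ((s : ℤ) - (t : ℤ)) *
      (if (s : ℤ) - (t : ℤ) = 0 then 1 else 0) = ∫ x, f x ∂haarAddCircle := fun s => by
    rw [Finset.sum_eq_single s]
    · simp [h0]
    · intro t _ hts
      rw [if_neg, mul_zero]
      exact fun h => hts (Fin.ext (by omega))
    · simp
  simp only [fejerMean_eq_sum]
  rw [integral_const_mul, integral_finsetSum _ fun s _ => integrable_finsetSum _ fun t _ => hi s t]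
  simp_rw [integral_finsetSum _ fun t _ => hi _ t, integral_const_mul, integral_fourier, hs]
  rw [Finset.sum_const, Finset.card_univ, Fintype.card_fin, nsmul_eq_mul,
    inv_mul_cancel_left₀ (Nat.cast_ne_zero.2 hn)]

/-- Fejér means are contractions in `L¹`. -/
lemma integral_norm_fejerMean_le {n : ℕ} (hn : n ≠ 0) {f : AddCircle T → ℂ}
    (hf : Integrable f haarAddCircle) :
    ∫ x, ‖fejerMean n f x‖ ∂haarAddCircle ≤ ∫ x, ‖f x‖ ∂haarAddCircle := by
  have h1 : ∀ x, fejerMean n (fun y => ((‖f y‖ : ℝ) : ℂ)) x = (((n : ℝ)⁻¹ *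
      ∫ y, ‖f y‖ * ‖⟪waveVector n y, waveVector n x⟫_ℂ‖ ^ 2 ∂haarAddCircle : ℝ) : ℂ) := fun x => by
    rw [fejerMean, inner_fourierToeplitz_ofReal hf.norm]
    push_cast
    rfl
  have h2 : ∀ x, ‖fejerMean n f x‖ ≤ (fejerMean n (fun y => ((‖f y‖ : ℝ) : ℂ)) x).re := fun x => by
    rw [h1, Complex.ofReal_re, fejerMean, inner_fourierToeplitz hf, norm_mul, norm_inv,
      Complex.norm_natCast]
    gcongr
    refine (norm_integral_le_integral_norm _).trans (le_of_eq ?_)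
    simp only [norm_mul, Complex.norm_real, norm_pow, norm_norm]
  have hi := integrable_of_continuous (continuous_fejerMean n fun y => ((‖f y‖ : ℝ) : ℂ))
  refine (integral_mono (integrable_of_continuous (continuous_fejerMean n f).norm) hi.re h2).trans
    (le_of_eq ?_)
  have h3 := integral_re hi
  rw [integral_fejerMean hn, integral_complex_ofReal] at h3
  exact h3

lemma norm_fejerMean_fourier_sub_le {n : ℕ} (hn : n ≠ 0) (k : ℤ) (x : AddCircle T) :
    ‖fejerMean n (fourier k) x - fourier k x‖ ≤ (k.natAbs : ℝ) / n := by
  set S : Finset (Fin n) := Finset.univ.filter fun s => ¬(0 ≤ (s : ℤ) - k ∧ (s : ℤ) - k < n)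
    with hS
  have hcard : S.card ≤ k.natAbs := by
    have h1 : S.card ≤ (Finset.Ico 0 k ∪ Finset.Ico ((n : ℤ) + k) n).card := by
      refine Finset.card_le_card_of_injOn (fun s : Fin n => (s : ℤ)) (fun s hs => ?_)
        (fun s _ t _ hst => Fin.ext (by simpa using hst))
      have := s.2
      simp only [hS, Finset.coe_filter, Finset.mem_univ, true_and, Set.mem_ofPred_eq] at hs
      simp only [Finset.coe_union, Finset.coe_Ico, Set.mem_union, Set.mem_Ico]
      omega
    have h2 := Finset.card_union_le (Finset.Ico 0 k) (Finset.Ico ((n : ℤ) + k) n)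
    simp only [Int.card_Ico] at h2
    omega
  have hs : ∀ s : Fin n, ∑ t : Fin n, (Pi.single k 1 : ℤ → ℂ) ((s : ℤ) - (t : ℤ)) *
      fourier ((s : ℤ) - (t : ℤ)) x =
      fourier k x - if ¬(0 ≤ (s : ℤ) - k ∧ (s : ℤ) - k < n) then fourier k x else 0 := fun s => by
    by_cases h : 0 ≤ (s : ℤ) - k ∧ (s : ℤ) - k < n
    swap
    · rw [if_pos h, sub_self]
      refine Finset.sum_eq_zero fun t _ => ?_
      rw [Pi.single_apply, if_neg, zero_mul]
      have := t.2
      omega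
    · rw [if_neg (not_not.2 h), sub_zero]
      rw [Finset.sum_eq_single ⟨((s : ℤ) - k).toNat, by omega⟩]
      · have : (s : ℤ) - ((((s : ℤ) - k).toNat : ℕ) : ℤ) = k := by omega
        simp only [this, Pi.single_eq_same, one_mul]
      · intro t _ ht
        rw [Pi.single_apply, if_neg, zero_mul]
        exact fun h' => ht (Fin.ext (by simp only; omega))
      · simp
  have hn' : (n : ℂ) ≠ 0 := Nat.cast_ne_zero.2 hn
  have h : fejerMean n (fourier k) x - fourier k x = -((n : ℂ)⁻¹ * (S.card * fourier k x)) := by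
    rw [fejerMean_eq_sum, fourierCoeff_fourier]
    simp_rw [hs]
    rw [Finset.sum_sub_distrib, ← Finset.sum_filter, ← hS, Finset.sum_const, Finset.sum_const,
      Finset.card_univ, Fintype.card_fin, nsmul_eq_mul, nsmul_eq_mul, mul_sub,
      inv_mul_cancel_left₀ hn']
    ring
  rw [h, norm_neg, norm_mul, norm_mul, norm_fourier_apply, norm_inv, Complex.norm_natCast,
    Complex.norm_natCast, mul_one, inv_mul_eq_div]
  gcongr

lemma tendsto_integral_norm_fejerMean_sub_of_approx {f : AddCircle T → ℂ}
    (hf : Integrable f haarAddCircle)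
    (h : ∀ ε > 0, ∃ g : AddCircle T → ℂ, Integrable g haarAddCircle ∧
      ∫ x, ‖f x - g x‖ ∂haarAddCircle ≤ ε ∧
      Tendsto (fun n => ∫ x, ‖fejerMean n g x - g x‖ ∂haarAddCircle) atTop (nhds 0)) :
    Tendsto (fun n => ∫ x, ‖fejerMean n f x - f x‖ ∂haarAddCircle) atTop (nhds 0) := by
  rw [Metric.tendsto_atTop]
  intro ε hε
  obtain ⟨g, hg, hfg, hlim⟩ := h (ε / 3) (by positivity)
  obtain ⟨N, hN⟩ := Metric.tendsto_atTop.1 hlim (ε / 3) (by positivity)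
  refine ⟨max N 1, fun n hn => ?_⟩
  have hn0 : n ≠ 0 := by have := le_of_max_le_right hn; omega
  have hSi : ∀ u : AddCircle T → ℂ, Integrable (fejerMean n u) haarAddCircle :=
    fun u => integrable_of_continuous (continuous_fejerMean n u)
  have h1 := hN n (le_of_max_le_left hn)
  rw [Real.dist_0_eq_abs, abs_of_nonneg (by positivity)] at h1 ⊢
  have h2 := integral_norm_fejerMean_le hn0 (hf.sub hg)
  calc ∫ x, ‖fejerMean n f x - f x‖ ∂haarAddCircle
      ≤ ∫ x, (‖fejerMean n (f - g) x‖ + ‖fejerMean n g x - g x‖ + ‖f x - g x‖)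
          ∂haarAddCircle := by
        refine integral_mono ((hSi f).sub hf).norm
          (((hSi _).norm.add ((hSi g).sub hg).norm).add (hf.sub hg).norm) fun x => ?_
        simp only [fejerMean_sub n hf hg]
        calc ‖fejerMean n f x - f x‖ = ‖(fejerMean n f x - fejerMean n g x) +
              (fejerMean n g x - g x) - (f x - g x)‖ := by congr 1; ring
          _ ≤ _ := (norm_sub_le _ _).trans (by gcongr; exact norm_add_le _ _)
    _ = (∫ x, ‖fejerMean n (f - g) x‖ ∂haarAddCircle) +
          (∫ x, ‖fejerMean n g x - g x‖ ∂haarAddCircle) + ∫ x, ‖f x - g x‖ ∂haarAddCircle := by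
        refine (integral_add ((hSi _).norm.add ((hSi g).sub hg).norm) (hf.sub hg).norm).trans ?_
        congr 1
        exact integral_add (hSi _).norm ((hSi g).sub hg).norm
    _ < ε := by
        simp only [Pi.sub_apply] at h2
        linarith

lemma tendsto_integral_norm_fejerMean_sub_of_mem_span {g : C(AddCircle T, ℂ)}
    (hg : g ∈ Submodule.span ℂ (Set.range (@fourier T))) :
    Tendsto (fun n => ∫ x, ‖fejerMean n g x - g x‖ ∂haarAddCircle) atTop (nhds 0) := by
  have hi : ∀ u : C(AddCircle T, ℂ), Integrable u haarAddCircle :=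
    fun u => integrable_of_continuous (map_continuous u)
  have hSi : ∀ (n : ℕ) (u : C(AddCircle T, ℂ)),
      Integrable (fun x => ‖fejerMean n u x - u x‖) haarAddCircle :=
    fun n u => ((integrable_of_continuous (continuous_fejerMean n u)).sub (hi u)).norm
  induction hg using Submodule.span_induction with
  | mem g hg =>
    obtain ⟨k, rfl⟩ := hg
    refine squeeze_zero' (Eventually.of_forall fun n => by positivity) ?_
      (tendsto_const_div_atTop_nhds_zero_nat (k.natAbs : ℝ))
    filter_upwards [eventually_ne_atTop 0] with n hn
    refine (integral_mono (hSi n _) (integrable_const _)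
      (norm_fejerMean_fourier_sub_le hn k)).trans (le_of_eq ?_)
    simp
  | zero =>
    have h : ∀ (n : ℕ) (x : AddCircle T), fejerMean n (0 : AddCircle T → ℂ) x = 0 :=
      fun n x => by simpa using fejerMean_const_smul n 0 (0 : AddCircle T → ℂ) x
    simp [h]
  | add u v _ _ hu hv =>
    refine squeeze_zero (fun n => by positivity) (fun n => ?_) (by simpa using hu.add hv)
    rw [← integral_add (hSi n u) (hSi n v)]
    refine integral_mono (hSi n _) ((hSi n u).add (hSi n v)) fun x => ?_
    simp only [ContinuousMap.coe_add, fejerMean_add n (hi u) (hi v), Pi.add_apply,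
      add_sub_add_comm]
    exact norm_add_le _ _
  | smul c u _ hu =>
    simp only [ContinuousMap.coe_smul, fejerMean_const_smul, Pi.smul_apply, smul_eq_mul,
      ← mul_sub, norm_mul, integral_const_mul]
    simpa using hu.const_mul ‖c‖

/-- Fejér means converge in `L¹`. -/
lemma tendsto_integral_norm_fejerMean_sub {f : AddCircle T → ℂ}
    (hf : Integrable f haarAddCircle) :
    Tendsto (fun n => ∫ x, ‖fejerMean n f x - f x‖ ∂haarAddCircle) atTop (nhds 0) := by
  refine tendsto_integral_norm_fejerMean_sub_of_approx hf fun ε hε => ?_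
  obtain ⟨g, hfg, hg⟩ := hf.exists_boundedContinuous_integral_sub_le hε
  refine ⟨g, hg, hfg, tendsto_integral_norm_fejerMean_sub_of_approx hg fun δ hδ => ?_⟩
  have hmem : g.toContinuousMap ∈
      (Submodule.span ℂ (Set.range (@fourier T))).topologicalClosure := by
    rw [span_fourier_closure_eq_top]
    exact Submodule.mem_top
  obtain ⟨u, hu, hgu⟩ := Metric.mem_closure_iff.1 hmem δ hδ
  have hui : Integrable u haarAddCircle := integrable_of_continuous (map_continuous u)
  refine ⟨u, hui, ?_, tendsto_integral_norm_fejerMean_sub_of_mem_span hu⟩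
  refine (integral_mono (hg.sub hui).norm (integrable_const δ) fun x => ?_).trans
    (le_of_eq (by simp))
  rw [Pi.sub_apply, ← dist_eq_norm]
  exact (ContinuousMap.dist_apply_le_dist x).trans hgu.le

lemma tendsto_mean_abs_eigenvalues_sub {f : AddCircle T → ℝ} (hf : Integrable f haarAddCircle)
    (c : ℝ) :
    Tendsto (fun n : ℕ => (n : ℝ)⁻¹ *
        ∑ j, |(isHermitian_fourierToeplitz f n).eigenvalues j - c|) atTop
      (nhds (∫ x, |f x - c| ∂haarAddCircle)) := by
  have hlim := (tendsto_integral_norm_fejerMean_sub hf.ofReal).const_sub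
    (∫ x, |f x - c| ∂haarAddCircle)
  rw [sub_zero] at hlim
  refine tendsto_of_tendsto_of_tendsto_of_le_of_le' hlim tendsto_const_nhds ?_ ?_
  · filter_upwards [eventually_ne_atTop 0] with n hn
    refine le_trans ?_ (integral_norm_fejerMean_sub_le hn (isHermitian_fourierToeplitz f n) c)
    have hS := integrable_of_continuous (continuous_fejerMean n fun x => (f x : ℂ))
    have h1 : Integrable (fun x => ‖fejerMean n (fun x => (f x : ℂ)) x - (f x : ℂ)‖)
      haarAddCircle := (hS.sub hf.ofReal).norm
    have h2 : Integrable (fun x => ‖fejerMean n (fun x => (f x : ℂ)) x - (c : ℂ)‖)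
      haarAddCircle := (hS.sub (integrable_const _)).norm
    rw [sub_le_iff_le_add]
    refine le_trans ?_ (integral_add h2 h1).le
    refine integral_mono (hf.sub (integrable_const c)).abs (h2.add h1) fun x => ?_
    have h3 : |f x - c| = ‖(f x : ℂ) - c‖ := by
      rw [← Complex.ofReal_sub, Complex.norm_real, Real.norm_eq_abs]
    change |f x - c| ≤ ‖_ - _‖ + ‖_ - _‖
    rw [h3, norm_sub_rev (fejerMean n _ x) (f x : ℂ), add_comm]
    exact norm_sub_le_norm_sub_add_norm_sub _ _ _
  · filter_upwards [eventually_ne_atTop 0] with n hn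
    have hn' : (0 : ℝ) < n := by positivity
    rw [inv_mul_le_iff₀ hn']
    exact sum_abs_eigenvalues_sub_le hf _ c

end FejerJensen

section AbsDetermines

variable {Ω : Type*} [MeasurableSpace Ω] {μ : Measure Ω} {f : Ω → ℝ}
  {Λ : (n : ℕ) → Fin n → ℝ}

/-- The continuous function that vanishes on `(-∞, a]`, equals `1` on `[a + h, ∞)`, and is affine
in between. -/
noncomputable def linearRamp (a h x : ℝ) : ℝ := (2 * h)⁻¹ * (|x - a| - |x - (a + h)| + h)

lemma linearRamp_of_le {a h x : ℝ} (hh : 0 < h) (hx : x ≤ a) : linearRamp a h x = 0 := by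
  rw [linearRamp, abs_of_nonpos (by linarith), abs_of_nonpos (by linarith)]
  ring

lemma linearRamp_of_ge {a h x : ℝ} (hh : 0 < h) (hx : a + h ≤ x) : linearRamp a h x = 1 := by
  rw [linearRamp, abs_of_nonneg (by linarith), abs_of_nonneg (by linarith)]
  field_simp
  ring

lemma linearRamp_of_mem {a h x : ℝ} (hh : 0 < h) (h1 : a ≤ x) (h2 : x ≤ a + h) :
    linearRamp a h x = (x - a) / h := by
  rw [linearRamp, abs_of_nonneg (by linarith), abs_of_nonpos (by linarith)]
  field_simp
  ring

/-- The piecewise linear interpolation of `F` at the `N + 1` nodes `a, a + h, …, a + N * h`,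
normalized to vanish at `a`. -/
noncomputable def linearInterpolation (F : ℝ → ℂ) (a h : ℝ) (N : ℕ) (x : ℝ) : ℂ :=
  ∑ k ∈ Finset.range N, (F (a + (k + 1) * h) - F (a + k * h)) * linearRamp (a + k * h) h x

lemma linearInterpolation_of_ge (F : ℝ → ℂ) {a h : ℝ} (hh : 0 < h) (N : ℕ) {x : ℝ}
    (hx : a + N * h ≤ x) : linearInterpolation F a h N x = F (a + N * h) - F a := by
  have h1 : linearInterpolation F a h N x =
      ∑ k ∈ Finset.range N, (F (a + ((k + 1 : ℕ) : ℝ) * h) - F (a + (k : ℝ) * h)) := by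
    refine Finset.sum_congr rfl fun k hk => ?_
    have hk' : ((k + 1 : ℕ) : ℝ) ≤ N := Nat.cast_le.2 (Finset.mem_range.1 hk)
    have := mul_le_mul_of_nonneg_right hk' hh.le
    push_cast at this
    rw [linearRamp_of_ge hh (by linarith)]
    push_cast
    ring
  rw [h1, Finset.sum_range_sub (fun k : ℕ => F (a + (k : ℝ) * h))]
  simp

lemma norm_linearInterpolation_sub_le {F : ℝ → ℂ} {a h ε : ℝ} (hh : 0 < h)
    (hF : ∀ x y, |x - y| ≤ h → ‖F x - F y‖ ≤ ε) (hFa : ∀ x ≤ a, F x = 0) (N : ℕ) {x : ℝ}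
    (hx : x ≤ a + N * h) : ‖linearInterpolation F a h N x - F x‖ ≤ ε := by
  induction N with
  | zero =>
    have hε : 0 ≤ ε := (norm_nonneg _).trans (hF 0 0 (by simpa using hh.le))
    simpa [linearInterpolation, hFa x (by simpa using hx)] using hε
  | succ N ih =>
    have hrec : linearInterpolation F a h (N + 1) x = linearInterpolation F a h N x +
        (F (a + (N + 1) * h) - F (a + N * h)) * linearRamp (a + N * h) h x :=
      Finset.sum_range_succ _ _
    push_cast at hx
    rcases le_total x (a + N * h) with hxN | hxN
    · rw [hrec, linearRamp_of_le hh hxN, Complex.ofReal_zero, mul_zero, add_zero]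
      exact ih hxN
    · set t : ℝ := (x - (a + N * h)) / h with ht
      have ht0 : 0 ≤ t := div_nonneg (by linarith) hh.le
      have ht1 : t ≤ 1 := (div_le_one hh).2 (by linarith)
      have h1 : linearInterpolation F a h (N + 1) x - F x =
          ((1 - t : ℝ) : ℂ) * (F (a + N * h) - F x) +
            (t : ℂ) * (F (a + (N + 1) * h) - F x) := by
        rw [hrec, linearInterpolation_of_ge F hh N hxN, hFa a le_rfl,
          linearRamp_of_mem hh hxN (by linarith), ← ht]
        push_cast
        ring
      rw [h1]
      refine (norm_add_le _ _).trans ?_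
      rw [norm_mul, norm_mul, Complex.norm_real, Complex.norm_real, Real.norm_of_nonneg ht0,
        Real.norm_of_nonneg (sub_nonneg.2 ht1)]
      have e1 := hF (a + N * h) x (by rw [abs_le]; constructor <;> linarith)
      have e2 := hF (a + (N + 1) * h) x (by rw [abs_le]; constructor <;> linarith)
      nlinarith [mul_le_mul_of_nonneg_left e1 (sub_nonneg.2 ht1),
        mul_le_mul_of_nonneg_left e2 ht0]

/-- A compactly supported continuous function is a uniform limit of linear combinations of
ramps. -/
lemma exists_linearInterpolation_approx {F : ℝ → ℂ} (hF : Continuous F)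
    (hc : HasCompactSupport F) {ε : ℝ} (hε : 0 < ε) :
    ∃ (a h : ℝ) (N : ℕ), ∀ x, ‖linearInterpolation F a h N x - F x‖ ≤ ε := by
  obtain ⟨δ, hδ, hFδ⟩ := Metric.uniformContinuous_iff.1
    (hc.uniformContinuous_of_continuous hF) ε hε
  obtain ⟨R, hR⟩ := hc.isCompact.isBounded.subset_ball (0 : ℝ)
  have hzero : ∀ x, R ≤ |x| → F x = 0 := fun x hx => by
    by_contra hne
    have := hR (subset_tsupport F hne)
    rw [mem_ball_zero_iff, Real.norm_eq_abs] at this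
    linarith
  obtain ⟨N, hN⟩ := exists_nat_ge (2 * |R| / (δ / 2))
  rw [div_le_iff₀ (by positivity)] at hN
  have hRR := le_abs_self R
  have hR0 := abs_nonneg R
  have hFa : ∀ x ≤ -|R|, F x = 0 := fun x hx => hzero x (by
    rw [abs_of_nonpos (by linarith)]
    linarith)
  refine ⟨-|R|, δ / 2, N, fun x => ?_⟩
  rcases le_total x (-|R| + N * (δ / 2)) with hx | hx
  · refine norm_linearInterpolation_sub_le (half_pos hδ) (fun x y hxy => ?_) hFa N hx
    rw [← dist_eq_norm]
    exact (hFδ (by rw [Real.dist_eq]; linarith)).le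
  · have hp : ∀ y, -|R| + N * (δ / 2) ≤ y → F y = 0 := fun y hy => hzero y (by
      rw [abs_of_nonneg (by linarith)]
      linarith)
    rw [linearInterpolation_of_ge F (half_pos hδ) N hx, hp _ le_rfl, hFa _ le_rfl, hp x hx]
    simpa using hε.le

lemma integrable_linearRamp_comp [IsFiniteMeasure μ] (hf : Integrable f μ) (a h : ℝ) :
    Integrable (fun ω => linearRamp a h (f ω)) μ :=
  ((((hf.sub (integrable_const a)).abs).sub (hf.sub (integrable_const (a + h))).abs).add
    (integrable_const h)).const_mul _

lemma tendsto_mean_linearRamp [IsProbabilityMeasure μ] (hf : Integrable f μ)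
    (habs : ∀ c, Tendsto (fun n : ℕ => (n : ℝ)⁻¹ * ∑ j, |Λ n j - c|) atTop
      (nhds (∫ ω, |f ω - c| ∂μ))) (a h : ℝ) :
    Tendsto (fun n : ℕ => (n : ℝ)⁻¹ * ∑ j, linearRamp a h (Λ n j)) atTop
      (nhds (∫ ω, linearRamp a h (f ω) ∂μ)) := by
  have hi : ∀ c, Integrable (fun ω => |f ω - c|) μ := fun c => (hf.sub (integrable_const c)).abs
  have hlim : ∫ ω, linearRamp a h (f ω) ∂μ =
      (2 * h)⁻¹ * (∫ ω, |f ω - a| ∂μ - ∫ ω, |f ω - (a + h)| ∂μ + h) := by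
    simp only [linearRamp]
    have h1 : ∫ ω, (|f ω - a| - |f ω - (a + h)| + h) ∂μ =
        ∫ ω, (|f ω - a| - |f ω - (a + h)|) ∂μ + ∫ _, h ∂μ :=
      integral_add ((hi a).sub (hi (a + h))) (integrable_const h)
    rw [integral_const_mul, h1, integral_sub (hi a) (hi _)]
    simp
  rw [hlim]
  refine ((((habs a).sub (habs (a + h))).add_const h).const_mul (2 * h)⁻¹).congr' ?_
  filter_upwards [eventually_ne_atTop 0] with n hn
  have hn' : (n : ℝ) ≠ 0 := Nat.cast_ne_zero.2 hn
  simp only [linearRamp, ← Finset.mul_sum, Finset.sum_add_distrib, Finset.sum_sub_distrib,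
    Finset.sum_const, Finset.card_univ, Fintype.card_fin, nsmul_eq_mul]
  field_simp

lemma tendsto_mean_linearInterpolation [IsProbabilityMeasure μ] (hf : Integrable f μ)
    (habs : ∀ c, Tendsto (fun n : ℕ => (n : ℝ)⁻¹ * ∑ j, |Λ n j - c|) atTop
      (nhds (∫ ω, |f ω - c| ∂μ))) (F : ℝ → ℂ) (a h : ℝ) (N : ℕ) :
    Tendsto (fun n : ℕ => (n : ℂ)⁻¹ * ∑ j, linearInterpolation F a h N (Λ n j)) atTop
      (nhds (∫ ω, linearInterpolation F a h N (f ω) ∂μ)) := by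
  have h1 := tendsto_finsetSum (Finset.range N) fun k _ =>
    ((Complex.continuous_ofReal.tendsto _).comp
      (tendsto_mean_linearRamp hf habs (a + k * h) h)).const_mul
        (F (a + (k + 1) * h) - F (a + k * h))
  simp only [linearInterpolation]
  have hi : ∀ k ∈ Finset.range N, Integrable (fun ω => (F (a + (k + 1) * h) - F (a + k * h)) *
      (linearRamp (a + k * h) h (f ω) : ℂ)) μ := fun k _ =>
    (integrable_linearRamp_comp hf (a + k * h) h).ofReal.const_mul _
  rw [integral_finsetSum _ hi]
  simp only [integral_const_mul, integral_complex_ofReal]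
  refine h1.congr fun n => ?_
  rw [Finset.sum_comm, Finset.mul_sum]
  refine Finset.sum_congr rfl fun k _ => ?_
  rw [← Finset.mul_sum, Function.comp_apply, Complex.ofReal_mul, Complex.ofReal_inv,
    Complex.ofReal_natCast, Complex.ofReal_sum]
  ring

/-- Convergence of the means of the functions `|· - c|` implies convergence of the means of all
compactly supported continuous functions. -/
lemma tendsto_mean_of_tendsto_mean_abs_sub [IsProbabilityMeasure μ] (hf : Integrable f μ)
    (habs : ∀ c, Tendsto (fun n : ℕ => (n : ℝ)⁻¹ * ∑ j, |Λ n j - c|) atTop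
      (nhds (∫ ω, |f ω - c| ∂μ))) {F : ℝ → ℂ} (hF : Continuous F) (hc : HasCompactSupport F) :
    Tendsto (fun n : ℕ => (n : ℂ)⁻¹ * ∑ j, F (Λ n j)) atTop (nhds (∫ ω, F (f ω) ∂μ)) := by
  rw [Metric.tendsto_atTop]
  intro ε hε
  obtain ⟨a, h, N, hP⟩ := exists_linearInterpolation_approx hF hc
    (show (0 : ℝ) < ε / 4 by positivity)
  set P := linearInterpolation F a h N with hPdef
  obtain ⟨n₀, hn₀⟩ := Metric.tendsto_atTop.1
    (tendsto_mean_linearInterpolation hf habs F a h N) (ε / 4) (by positivity)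
  refine ⟨n₀, fun n hn => ?_⟩
  have h1 : dist ((n : ℂ)⁻¹ * ∑ j, F (Λ n j)) ((n : ℂ)⁻¹ * ∑ j, P (Λ n j)) ≤ ε / 4 := by
    rw [dist_comm, dist_eq_norm, ← mul_sub, ← Finset.sum_sub_distrib, norm_mul, norm_inv,
      Complex.norm_natCast]
    have h2 : ‖∑ j, (P (Λ n j) - F (Λ n j))‖ ≤ n * (ε / 4) := by
      simpa using norm_sum_le_of_le Finset.univ fun j _ => hP (Λ n j)
    rcases Nat.eq_zero_or_pos n with rfl | hpos
    · simpa using (by positivity : 0 ≤ ε / 4)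
    · rwa [inv_mul_le_iff₀ (Nat.cast_pos.2 hpos)]
  have h3 : dist (∫ ω, P (f ω) ∂μ) (∫ ω, F (f ω) ∂μ) ≤ ε / 4 := by
    have hPi : Integrable (fun ω => P (f ω)) μ := integrable_finsetSum _ fun k _ =>
      (integrable_linearRamp_comp hf (a + k * h) h).ofReal.const_mul _
    have hFi : Integrable (fun ω => F (f ω)) μ := by
      obtain ⟨C, hC⟩ := hc.exists_bound_of_continuous hF
      exact Integrable.of_bound (hF.comp_aestronglyMeasurable hf.aestronglyMeasurable) C
        (ae_of_all _ fun ω => hC _)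
    rw [dist_eq_norm, ← integral_sub hPi hFi]
    simpa using norm_integral_le_of_norm_le_const (μ := μ) (ae_of_all _ fun ω => hP (f ω))
  have h4 := hn₀ n hn
  have h5 := dist_triangle4 ((n : ℂ)⁻¹ * ∑ j, F (Λ n j)) ((n : ℂ)⁻¹ * ∑ j, P (Λ n j))
    (∫ ω, P (f ω) ∂μ) (∫ ω, F (f ω) ∂μ)
  linarith

end AbsDetermines

section Transfer

open AddCircle

variable {T : ℝ} [hT : Fact (0 < T)]

lemma MeasureTheory.IntegrableOn.integrable_liftIoc_haarAddCircle {f : ℝ → ℝ} {a : ℝ}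
    (hf : IntegrableOn f (Set.Ioc a (a + T))) : Integrable (liftIoc T a f) haarAddCircle := by
  have h : MemLp (fun θ => (f θ : ℂ)) 1 (volume.restrict (Set.Ioc a (a + T))) :=
    memLp_one_iff_integrable.2 hf.ofReal
  exact (memLp_one_iff_integrable.1 (memLp_haarAddCircle_iff.2 h.memLp_liftIoc)).re

lemma integral_comp_liftIoc_haarAddCircle (f : ℝ → ℝ) (a : ℝ) (G : ℝ → ℂ) :
    ∫ x, G (liftIoc T a f x) ∂haarAddCircle = (T : ℂ)⁻¹ * ∫ θ in a..a + T, G (f θ) := by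
  rw [integral_haarAddCircle]
  have h := integral_liftIoc_eq_intervalIntegral (T := T) (t := a) (f := G ∘ f)
  simp only [liftIoc_comp_apply, Function.comp_apply] at h
  rw [h, Complex.real_smul, Complex.ofReal_inv]

lemma fourierCoeff_ofReal_liftIoc (f : ℝ → ℝ) (a : ℝ) (k : ℤ) :
    fourierCoeff (fun x => ((liftIoc T a f x : ℝ) : ℂ)) k =
      (T : ℂ)⁻¹ * ∫ θ in a..a + T,
        (f θ : ℂ) * Complex.exp (-(2 * Real.pi * Complex.I * k * θ / T)) := by
  rw [fourierCoeff_eq_intervalIntegral _ _ a, Complex.real_smul, one_div, Complex.ofReal_inv]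
  congr 1
  refine intervalIntegral.integral_congr_ae (ae_of_all _ fun θ hθ => ?_)
  rw [Set.uIoc_of_le (by linarith [hT.out])] at hθ
  rw [liftIoc_coe_apply hθ, fourier_coe_apply, smul_eq_mul, mul_comm]
  congr 2
  rw [Int.cast_neg]
  ring

end Transfer

/-- If `f ∈ L¹([-π,π])` is real-valued and `T n` is the `n×n` Toeplitz
matrix built from its Fourier coefficients, then each `T n` is Hermitian and `{T n}ₙ`
has asymptotic eigenvalue distribution described by `f` (the eigenvalues, counted with
multiplicity, are the roots of the characteristic polynomial). -/
theorem toeplitz_eigenvalue_distribution_real_symbol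
    (f : ℝ → ℝ) (hf : IntegrableOn f (Set.Icc (-Real.pi) Real.pi))
    (a : ℤ → ℂ)
    (ha : ∀ k : ℤ, a k =
      (1 / (2 * Real.pi) : ℂ) *
        ∫ θ in (-Real.pi)..Real.pi, (f θ : ℂ) * Complex.exp (-Complex.I * k * θ))
    (T : (n : ℕ) → Matrix (Fin n) (Fin n) ℂ)
    (hT : ∀ n, ∀ s t : Fin n, T n s t = a ((s : ℤ) - (t : ℤ))) :
    (∀ n, (T n).IsHermitian) ∧
    ∀ F : ℂ → ℂ, Continuous F → HasCompactSupport F →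
      Tendsto (fun n : ℕ => (n : ℂ)⁻¹ * (((T n).charpoly.roots).map F).sum) atTop
        (nhds ((1 / (2 * Real.pi) : ℂ) *
          ∫ θ in (-Real.pi)..Real.pi, F ((f θ : ℂ)))) := by
  have : Fact (0 < 2 * Real.pi) := ⟨Real.two_pi_pos⟩
  have hend : -Real.pi + 2 * Real.pi = Real.pi := by ring
  set g : AddCircle (2 * Real.pi) → ℝ := AddCircle.liftIoc (2 * Real.pi) (-Real.pi) f with hg
  have hgi : Integrable g AddCircle.haarAddCircle :=
    IntegrableOn.integrable_liftIoc_haarAddCircle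
      (hf.mono_set (by rw [hend]; exact Set.Ioc_subset_Icc_self))
  have hTg : ∀ n, T n = fourierToeplitz (fun x => (g x : ℂ)) n := fun n => by
    ext s t
    rw [hT, ha, fourierToeplitz, Matrix.of_apply, hg, fourierCoeff_ofReal_liftIoc, hend, one_div]
    push_cast
    congr 2
    ext θ
    congr 2
    field_simp
  refine ⟨fun n => hTg n ▸ isHermitian_fourierToeplitz g n, fun F hF hc => ?_⟩
  have hlim := tendsto_mean_of_tendsto_mean_abs_sub hgi (tendsto_mean_abs_eigenvalues_sub hgi)
    (F := fun x => F (x : ℂ)) (hF.comp Complex.continuous_ofReal)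
    (hc.comp_isClosedEmbedding Complex.isometry_ofReal.isClosedEmbedding)
  rw [hg, integral_comp_liftIoc_haarAddCircle f (-Real.pi) fun x => F (x : ℂ), hend] at hlim
  rw [one_div]
  push_cast at hlim
  refine hlim.congr fun n => ?_
  rw [hTg, (isHermitian_fourierToeplitz g n).roots_charpoly_eq_eigenvalues, Multiset.map_map]
  rfl
end

section
/- Let {A_n}_n and, for each m, {B_{n,m}}_n be sequences of n×n Hermitian complex matrices, and let f, f_m : D ⊂ ℝ^k → ℝ be measurable functions on a set D with 0 < μ_k(D) < ∞. Suppose (1) for every m, {B_{n,m}}_n has asymptotic eigenvalue distribution described by f_m; (2) {{B_{n,m}}_n}_m is an approximating class of sequences for {A_n}_n, i.e. for every m there exist n_m, c(m), ω(m) with lim_{m→∞} c(m) = lim_{m→∞} ω(m) = 0 such that for all n ≥ n_m one can write A_n = B_{n,m} + R_{n,m} + N_{n,m} with rank(R_{n,m}) ≤ c(m)n and ‖N_{n,m}‖ ≤ ω(m) in spectral norm; (3) f_m → f in measure. Then {A_n}_n has asymptotic eigenvalue distribution described by f. -/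
open MeasureTheory Filter Matrix

/-- The spectral (operator 2-) norm of a square complex matrix. -/
noncomputable def specNorm {n : ℕ} (A : Matrix (Fin n) (Fin n) ℂ) : ℝ :=
  ‖Matrix.toEuclideanCLM (𝕜 := ℂ) (n := Fin n) A‖

section HermitianPerturbation

open scoped InnerProductSpace

variable {n : ℕ} {A B : Matrix (Fin n) (Fin n) ℂ}

lemma toEuclideanCLM_eigenvectorBasis (hA : A.IsHermitian) (i : Fin n) :
    Matrix.toEuclideanCLM (𝕜 := ℂ) (n := Fin n) A (hA.eigenvectorBasis i) =
      (hA.eigenvalues i : ℂ) • hA.eigenvectorBasis i := by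
  ext j
  have h := congrFun (hA.mulVec_eigenvectorBasis i) j
  simpa using h

lemma inner_eigenvectorBasis_toEuclideanCLM (hA : A.IsHermitian) (i : Fin n)
    (x : EuclideanSpace ℂ (Fin n)) :
    ⟪hA.eigenvectorBasis i, Matrix.toEuclideanCLM (𝕜 := ℂ) (n := Fin n) A x⟫_ℂ =
      (hA.eigenvalues i : ℂ) * ⟪hA.eigenvectorBasis i, x⟫_ℂ := by
  have hsa : IsSelfAdjoint (Matrix.toEuclideanCLM (𝕜 := ℂ) (n := Fin n) A) := by
    rw [IsSelfAdjoint, ← map_star, Matrix.star_eq_conjTranspose, hA.eq]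
  rw [← ContinuousLinearMap.adjoint_inner_left, ← ContinuousLinearMap.star_eq_adjoint, hsa.star_eq,
    toEuclideanCLM_eigenvectorBasis, inner_smul_left, Complex.conj_ofReal]

lemma re_inner_toEuclideanCLM_self (hA : A.IsHermitian) (x : EuclideanSpace ℂ (Fin n)) :
    (⟪x, Matrix.toEuclideanCLM (𝕜 := ℂ) (n := Fin n) A x⟫_ℂ).re =
      ∑ i, hA.eigenvalues i * ‖⟪hA.eigenvectorBasis i, x⟫_ℂ‖ ^ 2 := by
  rw [← hA.eigenvectorBasis.sum_inner_mul_inner, Complex.re_sum]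
  refine Finset.sum_congr rfl fun i _ => ?_
  rw [inner_eigenvectorBasis_toEuclideanCLM, mul_left_comm, Complex.re_ofReal_mul,
    ← inner_conj_symm, Complex.conj_mul', ← Complex.ofReal_pow, Complex.ofReal_re]

/-- Courant–Fischer type comparison: if `A` and `B` differ by `R + E`, then many large eigenvalues
of `A` and many small eigenvalues of `B` force a relation between the thresholds. -/
lemma le_add_specNorm_of_card_lt (hA : A.IsHermitian) (hB : B.IsHermitian)
    {R E : Matrix (Fin n) (Fin n) ℂ} (hABRE : A = B + R + E) {s t : ℝ} {S T : Finset (Fin n)}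
    (hS : ∀ i ∈ S, t ≤ hA.eigenvalues i) (hT : ∀ i ∈ T, hB.eigenvalues i ≤ s)
    (hcard : n + R.rank < S.card + T.card) : t ≤ s + specNorm E := by
  classical
  let u := hA.eigenvectorBasis
  let v := hB.eigenvectorBasis
  let Rl := Matrix.toEuclideanLin R
  let L : EuclideanSpace ℂ (Fin n) →ₗ[ℂ]
      ((↥(Sᶜ) → ℂ) × (↥(Tᶜ) → ℂ)) × LinearMap.range Rl :=
    ((LinearMap.pi fun i : ↥(Sᶜ) => (innerSL ℂ (u i)).toLinearMap).prod
      (LinearMap.pi fun i : ↥(Tᶜ) => (innerSL ℂ (v i)).toLinearMap)).prod Rl.rangeRestrict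
  have hker : LinearMap.ker L ≠ ⊥ := by
    apply LinearMap.ker_ne_bot_of_finrank_lt
    have hR : Module.finrank ℂ (LinearMap.range Rl) = R.rank := by
      rw [Matrix.rank_eq_finrank_range_toLin R (PiLp.basisFun 2 ℂ (Fin n))
        (PiLp.basisFun 2 ℂ (Fin n))]
      rfl
    have h1 := Finset.card_compl S
    have h2 := Finset.card_compl T
    have h3 := Finset.card_le_univ S
    have h4 := Finset.card_le_univ T
    simp only [Fintype.card_fin] at h1 h2 h3 h4
    simp only [Module.finrank_prod, Module.finrank_fintype_fun_eq_card, Fintype.card_coe, hR,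
      finrank_euclideanSpace_fin]
    omega
  obtain ⟨x, hxL, hx0⟩ := Submodule.exists_mem_ne_zero_of_ne_bot hker
  rw [LinearMap.mem_ker] at hxL
  have hxS : ∀ i ∉ S, ⟪u i, x⟫_ℂ = 0 := fun i hi =>
    congrFun (congrArg (fun z => z.1.1) hxL) ⟨i, Finset.mem_compl.2 hi⟩
  have hxT : ∀ i ∉ T, ⟪v i, x⟫_ℂ = 0 := fun i hi =>
    congrFun (congrArg (fun z => z.1.2) hxL) ⟨i, Finset.mem_compl.2 hi⟩
  have hxR : Matrix.toEuclideanCLM (𝕜 := ℂ) (n := Fin n) R x = 0 :=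
    congrArg (fun z => (z.2 : EuclideanSpace ℂ (Fin n))) hxL
  have hAx : t * ‖x‖ ^ 2 ≤ (⟪x, Matrix.toEuclideanCLM (𝕜 := ℂ) (n := Fin n) A x⟫_ℂ).re := by
    rw [re_inner_toEuclideanCLM_self hA, ← u.sum_sq_norm_inner_right, Finset.mul_sum]
    refine Finset.sum_le_sum fun i _ => ?_
    by_cases hi : i ∈ S
    · exact mul_le_mul_of_nonneg_right (hS i hi) (sq_nonneg _)
    · have := hxS i hi
      simp only [u] at this ⊢
      simp [this]
  have hBx : (⟪x, Matrix.toEuclideanCLM (𝕜 := ℂ) (n := Fin n) B x⟫_ℂ).re ≤ s * ‖x‖ ^ 2 := by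
    rw [re_inner_toEuclideanCLM_self hB, ← v.sum_sq_norm_inner_right, Finset.mul_sum]
    refine Finset.sum_le_sum fun i _ => ?_
    by_cases hi : i ∈ T
    · exact mul_le_mul_of_nonneg_right (hT i hi) (sq_nonneg _)
    · have := hxT i hi
      simp only [v] at this ⊢
      simp [this]
  have hEx : (⟪x, Matrix.toEuclideanCLM (𝕜 := ℂ) (n := Fin n) E x⟫_ℂ).re ≤
      specNorm E * ‖x‖ ^ 2 := by
    refine (Complex.re_le_norm _).trans ((norm_inner_le_norm _ _).trans ?_)
    have := (Matrix.toEuclideanCLM (𝕜 := ℂ) (n := Fin n) E).le_opNorm x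
    have h2 := mul_le_mul_of_nonneg_left this (norm_nonneg x)
    refine h2.trans_eq ?_
    rw [specNorm]
    ring
  have hsplit : (⟪x, Matrix.toEuclideanCLM (𝕜 := ℂ) (n := Fin n) A x⟫_ℂ).re =
      (⟪x, Matrix.toEuclideanCLM (𝕜 := ℂ) (n := Fin n) B x⟫_ℂ).re +
      (⟪x, Matrix.toEuclideanCLM (𝕜 := ℂ) (n := Fin n) E x⟫_ℂ).re := by
    rw [hABRE, map_add, map_add, _root_.add_apply, _root_.add_apply, hxR,
      add_zero, inner_add_right, Complex.add_re]
  have hpos : 0 < ‖x‖ ^ 2 := by positivity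
  refine le_of_mul_le_mul_right ?_ hpos
  linarith

/-- Sorted eigenvalues under a perturbation of rank `R.rank` plus a perturbation of small norm. -/
lemma eigenvalues₀_le_add_specNorm (hA : A.IsHermitian) (hB : B.IsHermitian)
    {R E : Matrix (Fin n) (Fin n) ℂ} (hABRE : A = B + R + E)
    {i j : Fin (Fintype.card (Fin n))} (hij : (j : ℕ) + R.rank ≤ i) :
    hA.eigenvalues₀ i ≤ hB.eigenvalues₀ j + specNorm E := by
  let e : Fin (Fintype.card (Fin n)) ≃ Fin n := Fintype.equivOfCardEq (Fintype.card_fin _)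
  refine le_add_specNorm_of_card_lt hA hB hABRE (S := (Finset.Iic i).map e.toEmbedding)
    (T := (Finset.Ici j).map e.toEmbedding) ?_ ?_ ?_
  · intro l hl
    obtain ⟨l, hl', rfl⟩ := Finset.mem_map.1 hl
    have : hA.eigenvalues (e l) = hA.eigenvalues₀ l := by simp [Matrix.IsHermitian.eigenvalues, e]
    exact (hA.eigenvalues₀_antitone (Finset.mem_Iic.1 hl')).trans_eq this.symm
  · intro l hl
    obtain ⟨l, hl', rfl⟩ := Finset.mem_map.1 hl
    have : hB.eigenvalues (e l) = hB.eigenvalues₀ l := by simp [Matrix.IsHermitian.eigenvalues, e]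
    exact this.trans_le (hB.eigenvalues₀_antitone (Finset.mem_Ici.1 hl'))
  · have hj := j.isLt
    simp only [Finset.card_map, Fin.card_Iic, Fin.card_Ici]
    have := Fintype.card_fin n
    omega

end HermitianPerturbation

/-- Two antitone sequences with values in `[-K, K]` that dominate each other's shifts up to `w`
are close in `ℓ¹` on initial segments. -/
lemma sum_abs_sub_le_of_antitone_of_shift_le {a b : ℕ → ℝ} {K w : ℝ} {r : ℕ} (n : ℕ)
    (ha : Antitone a) (hb : Antitone b) (haK : ∀ j, |a j| ≤ K) (hbK : ∀ j, |b j| ≤ K)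
    (hw : 0 ≤ w) (hab : ∀ j, a (j + r) ≤ b j + w) (hba : ∀ j, b (j + r) ≤ a j + w) :
    ∑ j ∈ Finset.range n, |a j - b j| ≤ 2 * (n * w) + 8 * K * r := by
  have hK : 0 ≤ K := (abs_nonneg _).trans (haK 0)
  have key : ∀ {a b : ℕ → ℝ}, Antitone b → (∀ j, |a j| ≤ K) → (∀ j, |b j| ≤ K) →
      (∀ j, a (j + r) ≤ b j + w) →
      ∑ j ∈ Finset.range n, max (a j - b j) 0 ≤ n * w + 4 * K * r := by
    intro a b hb haK hbK hab
    have hmono : ∑ j ∈ Finset.range n, max (a j - b j) 0 ≤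
        ∑ j ∈ Finset.range (r + n), max (a j - b j) 0 :=
      Finset.sum_le_sum_of_subset_of_nonneg (Finset.range_mono (by omega))
        fun _ _ _ => le_max_right _ _
    have hhead : ∑ j ∈ Finset.range r, max (a j - b j) 0 ≤ 2 * K * r := by
      have : ∀ j ∈ Finset.range r, max (a j - b j) 0 ≤ 2 * K := fun j _ =>
        max_le (by linarith [(abs_le.1 (haK j)).2, (abs_le.1 (hbK j)).1]) (by positivity)
      simpa [mul_comm] using Finset.sum_le_card_nsmul _ _ _ this
    have htail : ∑ j ∈ Finset.range n, max (a (r + j) - b (r + j)) 0 ≤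
        ∑ j ∈ Finset.range n, (b j - b (r + j) + w) := by
      refine Finset.sum_le_sum fun j _ => max_le ?_ ?_
      · have := hab j
        rw [add_comm j r] at this
        linarith
      · linarith [hb (Nat.le_add_left j r)]
    have htele : ∑ j ∈ Finset.range n, b j - ∑ j ∈ Finset.range n, b (r + j) ≤ 2 * K * r := by
      have h1 := Finset.sum_range_add b r n
      have h2 := Finset.sum_range_add b n r
      rw [add_comm r n] at h1
      have h3 : ∑ j ∈ Finset.range r, b j ≤ K * r := by
        simpa [mul_comm] using Finset.sum_le_card_nsmul (Finset.range r) b K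
          fun j _ => (abs_le.1 (hbK j)).2
      have h4 : -K * r ≤ ∑ j ∈ Finset.range r, b (n + j) := by
        simpa [mul_comm] using Finset.card_nsmul_le_sum (Finset.range r) (fun j => b (n + j)) (-K)
          fun j _ => (abs_le.1 (hbK _)).1
      linarith
    rw [Finset.sum_range_add] at hmono
    rw [Finset.sum_add_distrib, Finset.sum_sub_distrib, Finset.sum_const, Finset.card_range,
      nsmul_eq_mul] at htail
    linarith
  have h1 := key hb haK hbK hab
  have h2 := key ha hbK haK hba
  have : ∀ j, |a j - b j| = max (a j - b j) 0 + max (b j - a j) 0 := fun j => by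
    rcases le_total (a j) (b j) with h | h
    · rw [abs_of_nonpos (by linarith), max_eq_right (by linarith), max_eq_left (by linarith)]
      ring
    · rw [abs_of_nonneg (by linarith), max_eq_left (by linarith), max_eq_right (by linarith)]
      ring
  simp only [this, Finset.sum_add_distrib]
  linarith

/-- Truncation of a real number to the interval `[-K, K]`. -/
noncomputable def truncReal (K x : ℝ) : ℝ := max (-K) (min K x)

lemma truncReal_mono (K : ℝ) : Monotone (truncReal K) := fun _ _ h =>
  max_le_max le_rfl (min_le_min le_rfl h)

lemma abs_truncReal_le {K : ℝ} (hK : 0 ≤ K) (x : ℝ) : |truncReal K x| ≤ K :=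
  abs_le.2 ⟨le_max_left _ _, max_le (by linarith) (min_le_left _ _)⟩

lemma truncReal_add_le (K x : ℝ) {w : ℝ} (hw : 0 ≤ w) :
    truncReal K (x + w) ≤ truncReal K x + w := by
  unfold truncReal
  refine max_le (by linarith [le_max_left (-K) (min K x)]) ?_
  rcases le_total K x with h | h
  · rw [min_eq_left h]
    linarith [min_le_left K (x + w), le_max_right (-K) K]
  · rw [min_eq_right h]
    linarith [min_le_right K (x + w), le_max_right (-K) x]

lemma apply_truncReal_of_eq_zero {E : Type*} [Zero E] {G : ℝ → E} {K : ℝ} (hK : 0 ≤ K)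
    (hG : ∀ x, K ≤ |x| → G x = 0) (x : ℝ) : G (truncReal K x) = G x := by
  unfold truncReal
  rcases le_total K x with h | h
  · rw [min_eq_left h, max_eq_right (by linarith), hG K (le_abs_self K),
      hG x (h.trans (le_abs_self x))]
  · rw [min_eq_right h]
    rcases le_total (-K) x with h' | h'
    · rw [max_eq_right h']
    · rw [max_eq_left h', hG (-K) (by rw [abs_neg]; exact le_abs_self K),
        hG x (by linarith [neg_le_abs x])]

/-- The eigenvalues of a Hermitian matrix in decreasing order, truncated to `[-K, K]` and continued
by `-K`. -/
noncomputable def truncEigenvalues {n : ℕ} {A : Matrix (Fin n) (Fin n) ℂ} (hA : A.IsHermitian)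
    (K : ℝ) (j : ℕ) : ℝ :=
  if h : j < Fintype.card (Fin n) then truncReal K (hA.eigenvalues₀ ⟨j, h⟩) else -K

section TruncEigenvalues

variable {n : ℕ} {A B : Matrix (Fin n) (Fin n) ℂ}

lemma antitone_truncEigenvalues (hA : A.IsHermitian) (K : ℝ) :
    Antitone (truncEigenvalues hA K) := by
  intro i j hij
  unfold truncEigenvalues
  split_ifs with hj hi hi
  · exact truncReal_mono K (hA.eigenvalues₀_antitone hij)
  · omega
  · exact le_max_left _ _
  · exact le_rfl

lemma abs_truncEigenvalues_le (hA : A.IsHermitian) {K : ℝ} (hK : 0 ≤ K) (j : ℕ) :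
    |truncEigenvalues hA K j| ≤ K := by
  unfold truncEigenvalues
  split_ifs
  · exact abs_truncReal_le hK _
  · rw [abs_neg, abs_of_nonneg hK]

lemma truncEigenvalues_add_rank_le (hA : A.IsHermitian) (hB : B.IsHermitian)
    {R E : Matrix (Fin n) (Fin n) ℂ} (hABRE : A = B + R + E) {K : ℝ} (j : ℕ) :
    truncEigenvalues hA K (j + R.rank) ≤ truncEigenvalues hB K j + specNorm E := by
  have hE : 0 ≤ specNorm E := norm_nonneg _
  unfold truncEigenvalues
  split_ifs with h1 h2 h2
  · exact (truncReal_mono K (eigenvalues₀_le_add_specNorm hA hB hABRE le_rfl)).trans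
      (truncReal_add_le K _ hE)
  · omega
  · have : -K ≤ truncReal K (hB.eigenvalues₀ ⟨j, h2⟩) := le_max_left _ _
    linarith
  · linarith

lemma sum_range_truncEigenvalues {E : Type*} [AddCommMonoid E] (hA : A.IsHermitian) {K : ℝ}
    (hK : 0 ≤ K) {G : ℝ → E} (hG : ∀ x, K ≤ |x| → G x = 0) :
    ∑ j ∈ Finset.range n, G (truncEigenvalues hA K j) = ∑ i, G (hA.eigenvalues i) := by
  unfold Matrix.IsHermitian.eigenvalues
  rw [Equiv.sum_comp _ fun i => G (hA.eigenvalues₀ i),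
    show Finset.range n = Finset.range (Fintype.card (Fin n)) by rw [Fintype.card_fin],
    Finset.sum_range]
  refine Finset.sum_congr rfl fun i _ => ?_
  rw [truncEigenvalues, dif_pos i.isLt, apply_truncReal_of_eq_zero hK hG]

lemma sum_abs_truncEigenvalues_sub_le (hA : A.IsHermitian) (hB : B.IsHermitian)
    {R E : Matrix (Fin n) (Fin n) ℂ} (hABRE : A = B + R + E) {K : ℝ} (hK : 0 ≤ K) :
    ∑ j ∈ Finset.range n, |truncEigenvalues hA K j - truncEigenvalues hB K j| ≤
      2 * (n * specNorm E) + 8 * K * R.rank := by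
  have hBARE : B = A + -R + -E := by rw [hABRE]; abel
  have hR : (-R).rank = R.rank := by
    simpa using Matrix.rank_smul_of_mem_nonZeroDivisors (c := (-1 : ℂ)) R (by simp)
  have hE : specNorm (-E) = specNorm E := by rw [specNorm, map_neg, norm_neg, specNorm]
  refine sum_abs_sub_le_of_antitone_of_shift_le n (antitone_truncEigenvalues hA K)
    (antitone_truncEigenvalues hB K) (abs_truncEigenvalues_le hA hK)
    (abs_truncEigenvalues_le hB hK) (norm_nonneg _) (truncEigenvalues_add_rank_le hA hB hABRE)
    fun j => ?_
  have := truncEigenvalues_add_rank_le hB hA hBARE (K := K) j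
  rwa [hR, hE] at this

/-- The eigenvalue means of a compactly supported test function at `A` and `B` are close as soon as
`A - B` is the sum of a matrix of small relative rank and a matrix of small norm. -/
lemma norm_mean_eigenvalues_sub_le (hn : n ≠ 0) (hA : A.IsHermitian) (hB : B.IsHermitian)
    {R E : Matrix (Fin n) (Fin n) ℂ} (hABRE : A = B + R + E) {K : ℝ} (hK : 0 ≤ K)
    {G : ℝ → ℂ} (hG : ∀ x, K ≤ |x| → G x = 0) {η C : ℝ}
    (hGC : ∀ x y, ‖G x - G y‖ ≤ η + C * |x - y|) (hC : 0 ≤ C) {c w : ℝ}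
    (hc : (R.rank : ℝ) ≤ c * n) (hw : specNorm E ≤ w) :
    ‖(n : ℂ)⁻¹ * ∑ j, G (hA.eigenvalues j) - (n : ℂ)⁻¹ * ∑ j, G (hB.eigenvalues j)‖ ≤
      η + C * (2 * w + 8 * K * c) := by
  have hn' : (0 : ℝ) < n := by positivity
  rw [← mul_sub, norm_mul, norm_inv, Complex.norm_natCast, inv_mul_le_iff₀ hn',
    ← sum_range_truncEigenvalues hA hK hG, ← sum_range_truncEigenvalues hB hK hG,
    ← Finset.sum_sub_distrib]
  calc _ ≤ ∑ j ∈ Finset.range n,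
        (η + C * |truncEigenvalues hA K j - truncEigenvalues hB K j|) :=
        norm_sum_le_of_le _ fun j _ => hGC _ _
    _ = n * η + C * ∑ j ∈ Finset.range n,
          |truncEigenvalues hA K j - truncEigenvalues hB K j| := by
        rw [Finset.sum_add_distrib, ← Finset.mul_sum, Finset.sum_const, Finset.card_range,
          nsmul_eq_mul]
    _ ≤ n * η + C * (2 * (n * w) + 8 * K * (c * n)) := by
        have := sum_abs_truncEigenvalues_sub_le hA hB hABRE hK
        gcongr
        exact this.trans (by gcongr)
    _ = n * (η + C * (2 * w + 8 * K * c)) := by ring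

end TruncEigenvalues

/-- A bounded uniformly continuous function is Lipschitz up to an arbitrarily small error. -/
lemma UniformContinuous.exists_norm_sub_le_add_mul_abs {E : Type*} [SeminormedAddCommGroup E]
    {G : ℝ → E} (hG : UniformContinuous G) {M : ℝ} (hM : ∀ x, ‖G x‖ ≤ M) {η : ℝ} (hη : 0 < η) :
    ∃ C, 0 ≤ C ∧ ∀ x y, ‖G x - G y‖ ≤ η + C * |x - y| := by
  have hM0 : 0 ≤ M := (norm_nonneg _).trans (hM 0)
  obtain ⟨δ, hδ, h⟩ := Metric.uniformContinuous_iff.1 hG η hη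
  refine ⟨2 * M / δ, by positivity, fun x y => ?_⟩
  rcases lt_or_ge |x - y| δ with hxy | hxy
  · have := h (Real.dist_eq x y ▸ hxy)
    rw [dist_eq_norm] at this
    have : 0 ≤ 2 * M / δ * |x - y| := by positivity
    linarith
  · have h1 : 2 * M ≤ 2 * M / δ * |x - y| := by
      rw [div_mul_eq_mul_div, le_div_iff₀ hδ]
      gcongr
    linarith [norm_sub_le (G x) (G y), hM x, hM y]

/-- Convergence in measure on a set of finite measure implies convergence of the integrals of every
bounded continuous function. -/
lemma tendsto_setIntegral_comp_of_tendstoInMeasure {α E : Type*} [MeasurableSpace α]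
    [NormedAddCommGroup E] [NormedSpace ℝ E] {μ : Measure α} [IsFiniteMeasure μ]
    {f : α → ℝ} {fm : ℕ → α → ℝ} (hfm : ∀ m, Measurable (fm m))
    (h : TendstoInMeasure μ fm atTop f) {G : ℝ → E} (hG : Continuous G) {M : ℝ}
    (hM : ∀ x, ‖G x‖ ≤ M) :
    Tendsto (fun m => ∫ x, G (fm m x) ∂μ) atTop (nhds (∫ x, G (f x) ∂μ)) := by
  refine tendsto_of_subseq_tendsto fun ns hns => ?_
  obtain ⟨ms, -, hms⟩ := TendstoInMeasure.exists_seq_tendsto_ae fun ε hε => (h ε hε).comp hns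
  refine ⟨ms, tendsto_integral_of_dominated_convergence (fun _ => M)
    (fun m => (hG.stronglyMeasurable.comp_measurable (hfm _)).aestronglyMeasurable)
    (integrable_const M) (fun m => Eventually.of_forall fun x => hM _) ?_⟩
  filter_upwards [hms] with x hx using (hG.tendsto _).comp hx

/-- a.c.s. convergence, eigenvalue version for Hermitian matrices.
If the Hermitian sequences `{B m n}ₙ ∼_λ f_m` for every `m`, `{{B m n}ₙ}ₘ` is an
approximating class of sequences for the Hermitian sequence `{A n}ₙ`, and `f_m → f`
in measure, then `{A n}ₙ ∼_λ f`. -/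
theorem acs_eigenvalue_distribution_hermitian
    (k : ℕ) (D : Set (Fin k → ℝ)) (hD : MeasurableSet D)
    (hD0 : 0 < volume D) (hDfin : volume D < ⊤)
    (f : (Fin k → ℝ) → ℝ) (hf : Measurable f)
    (fm : ℕ → (Fin k → ℝ) → ℝ) (hfm : ∀ m, Measurable (fm m))
    (A : (n : ℕ) → Matrix (Fin n) (Fin n) ℂ) (hA : ∀ n, (A n).IsHermitian)
    (B : (m : ℕ) → (n : ℕ) → Matrix (Fin n) (Fin n) ℂ)
    (hB : ∀ m n, (B m n).IsHermitian)
    -- (1) for every m, {B m n}ₙ ∼_λ fm m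
    (hBdistr : ∀ m, ∀ F : ℂ → ℂ, Continuous F → HasCompactSupport F →
      Tendsto (fun n : ℕ => (n : ℂ)⁻¹ * ∑ j, F (((hB m n).eigenvalues j : ℂ))) atTop
        (nhds (((volume D).toReal : ℂ)⁻¹ * ∫ x in D, F ((fm m x : ℂ)))))
    -- (2) {{B m n}ₙ}ₘ is an a.c.s. for {A n}ₙ
    (hacs : ∃ (N : ℕ → ℕ) (c ω : ℕ → ℝ),
      Tendsto c atTop (nhds 0) ∧ Tendsto ω atTop (nhds 0) ∧
      ∀ m, ∀ n ≥ N m, ∃ R E : Matrix (Fin n) (Fin n) ℂ,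
        A n = B m n + R + E ∧ (R.rank : ℝ) ≤ c m * n ∧ specNorm E ≤ ω m)
    -- (3) fm → f in measure on D
    (hmeas : ∀ ε > (0 : ℝ),
      Tendsto (fun m : ℕ => volume {x ∈ D | ε < |fm m x - f x|}) atTop (nhds 0)) :
    ∀ F : ℂ → ℂ, Continuous F → HasCompactSupport F →
      Tendsto (fun n : ℕ => (n : ℂ)⁻¹ * ∑ j, F (((hA n).eigenvalues j : ℂ))) atTop
        (nhds (((volume D).toReal : ℂ)⁻¹ * ∫ x in D, F ((f x : ℂ)))) := by
  intro F hF hFc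
  obtain ⟨N, c, ω, hc, hω, hdecomp⟩ := hacs
  set G : ℝ → ℂ := fun x => F x with hGdef
  have hGcont : Continuous G := hF.comp Complex.continuous_ofReal
  have hGuc : UniformContinuous G :=
    (hF.uniformContinuous_of_tendsto_cocompact hFc.is_zero_at_infty).comp
      Complex.isometry_ofReal.uniformContinuous
  obtain ⟨M, hM⟩ := hF.bounded_above_of_compact_support hFc
  obtain ⟨K, hK, hGK⟩ : ∃ K : ℝ, 0 ≤ K ∧ ∀ x : ℝ, K ≤ |x| → G x = 0 := by
    obtain ⟨K, hK, hFK⟩ := hFc.exists_pos_le_norm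
    exact ⟨K, hK.le, fun x hx => hFK x (by simpa using hx)⟩
  have : IsFiniteMeasure (volume.restrict D) := isFiniteMeasure_restrict.2 hDfin.ne
  have hinmeas : TendstoInMeasure (volume.restrict D) fm atTop f := by
    rw [tendstoInMeasure_iff_norm]
    intro ε hε
    refine tendsto_of_tendsto_of_tendsto_of_le_of_le tendsto_const_nhds (hmeas (ε / 2) (half_pos hε))
      (fun _ => zero_le) fun m => ?_
    rw [Measure.restrict_apply' hD]
    refine measure_mono fun x hx => ⟨hx.2, ?_⟩
    have : ε ≤ |fm m x - f x| := hx.1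
    linarith
  have hint : Tendsto (fun m => ((volume D).toReal : ℂ)⁻¹ * ∫ x in D, G (fm m x)) atTop
      (nhds (((volume D).toReal : ℂ)⁻¹ * ∫ x in D, G (f x))) :=
    (tendsto_setIntegral_comp_of_tendstoInMeasure hfm hinmeas hGcont fun x => hM x).const_mul _
  rw [Metric.tendsto_atTop']
  intro ε hε
  obtain ⟨C, hC, hGC⟩ := hGuc.exists_norm_sub_le_add_mul_abs (fun x => hM x) (η := ε / 4)
    (by positivity)
  have hsmall : Tendsto (fun m => C * (2 * ω m + 8 * K * c m)) atTop (nhds 0) := by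
    simpa using ((hω.const_mul 2).add (hc.const_mul (8 * K))).const_mul C
  obtain ⟨m, hm1, hm2⟩ := ((hsmall.eventually_lt_const (show 0 < ε / 4 by positivity)).and
    (Metric.tendsto_nhds.1 hint (ε / 4) (by positivity))).exists
  obtain ⟨n₀, hn₀⟩ := Metric.tendsto_atTop.1 (hBdistr m F hF hFc) (ε / 4) (by positivity)
  refine ⟨max n₀ (N m), fun n hn => ?_⟩
  obtain ⟨R, E, hRE, hR, hE⟩ := hdecomp m n ((le_max_right _ _).trans hn.le)
  have h1 := norm_mean_eigenvalues_sub_le (by omega) (hA n) (hB m n) hRE hK hGK hGC hC hR hE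
  rw [← dist_eq_norm] at h1
  have h2 := hn₀ n ((le_max_left _ _).trans hn.le)
  have h3 := dist_triangle4 ((n : ℂ)⁻¹ * ∑ j, G ((hA n).eigenvalues j))
    ((n : ℂ)⁻¹ * ∑ j, G ((hB m n).eigenvalues j))
    (((volume D).toReal : ℂ)⁻¹ * ∫ x in D, G (fm m x))
    (((volume D).toReal : ℂ)⁻¹ * ∫ x in D, G (f x))
  simp only [hGdef] at h1 h2 h3 hm2 ⊢
  linarith
end

section
/- Let f ∈ L¹([-π,π]) have real Fourier coefficients a_k = (1/2π)∫_{-π}^{π} f(θ)e^{-ikθ}dθ ∈ ℝ, and assume f is sparsely vanishing (its zero set has Lebesgue measure zero). Let T_n[f] ∈ ℝ^{n×n} be the Toeplitz matrix with (s,t) entry a_{s-t} and Y_n the n×n anti-identity matrix; then Y_n T_n[f] is real symmetric and, denoting by n⁺(·) and n⁻(·) the numbers of positive and negative eigenvalues, one has |n⁺(Y_n T_n[f]) − n⁻(Y_n T_n[f])| = o(n) as n → ∞. -/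
open MeasureTheory Filter Matrix

/-- The character `θ ↦ exp (i k θ)`. -/
noncomputable def fourierChar (k : ℤ) (θ : ℝ) : ℂ := Complex.exp (Complex.I * k * θ)

/-- The trigonometric polynomial with coefficients `c k`. -/
noncomputable def trigPoly (c : ℤ →₀ ℂ) (θ : ℝ) : ℂ :=
  c.sum fun k z => z * fourierChar k θ

/-- Lebesgue measure on one period. -/
noncomputable abbrev periodMeasure : Measure ℝ := volume.restrict (Set.Ioc (-Real.pi) Real.pi)

lemma fourierChar_add (j k : ℤ) (θ : ℝ) :
    fourierChar (j + k) θ = fourierChar j θ * fourierChar k θ := by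
  simp only [fourierChar, ← Complex.exp_add]
  push_cast
  ring_nf

@[simp] lemma norm_fourierChar (k : ℤ) (θ : ℝ) : ‖fourierChar k θ‖ = 1 := by
  have : Complex.I * k * θ = ((k * θ : ℝ) : ℂ) * Complex.I := by push_cast; ring
  rw [fourierChar, this, Complex.norm_exp_ofReal_mul_I]

lemma conj_fourierChar (k : ℤ) (θ : ℝ) :
    (starRingEnd ℂ) (fourierChar k θ) = fourierChar (-k) θ := by
  simp [fourierChar, ← Complex.exp_conj]

lemma continuous_fourierChar (k : ℤ) : Continuous (fourierChar k) := by
  unfold fourierChar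
  fun_prop

lemma continuous_trigPoly (c : ℤ →₀ ℂ) : Continuous (trigPoly c) :=
  continuous_finsetSum _ fun k _ => continuous_const.mul (continuous_fourierChar k)

lemma Continuous.integrable_periodMeasure {E : Type*} [NormedAddCommGroup E] {g : ℝ → E}
    (hg : Continuous g) : Integrable g periodMeasure :=
  (hg.integrableOn_Icc (a := -Real.pi) (b := Real.pi)).mono_set Set.Ioc_subset_Icc_self

lemma integral_fourierChar_zero : ∫ θ, fourierChar 0 θ ∂periodMeasure = 2 * Real.pi := by
  have h : (volume.real (Set.Ioc (-Real.pi) Real.pi)) = 2 * Real.pi := by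
    rw [Real.volume_real_Ioc_of_le (by linarith [Real.pi_pos])]; ring
  simp [fourierChar, h]

lemma integral_fourierChar {k : ℤ} (hk : k ≠ 0) : ∫ θ, fourierChar k θ ∂periodMeasure = 0 := by
  rw [← intervalIntegral.integral_of_le (by linarith [Real.pi_pos])]
  unfold fourierChar
  rw [integral_exp_mul_complex (by simp [hk]), div_eq_zero_iff]
  left
  rw [sub_eq_zero, Complex.exp_eq_exp_iff_exists_int]
  exact ⟨k, by push_cast; ring⟩

lemma integral_trigPoly_mul_fourierChar {d : ℕ} {c : ℤ →₀ ℂ} (hc : ∀ k ∈ c.support, |k| ≤ d)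
    {j : ℤ} (hj : (d : ℤ) < |j|) :
    ∫ θ, trigPoly c θ * fourierChar j θ ∂periodMeasure = 0 := by
  simp only [trigPoly, Finsupp.sum, Finset.sum_mul, mul_assoc, ← fourierChar_add]
  have hint : ∀ k ∈ c.support,
      Integrable (fun θ => c k * fourierChar (k + j) θ) periodMeasure := fun k _ =>
    (continuous_const.mul (continuous_fourierChar _)).integrable_periodMeasure
  rw [integral_finsetSum _ hint]
  refine Finset.sum_eq_zero fun k hk => ?_
  rw [integral_const_mul, integral_fourierChar, mul_zero]
  have := abs_le.mp (hc k hk)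
  rcases lt_abs.mp hj with h | h <;> omega

/-- Trigonometric polynomials are dense in `L¹` of a finite measure on one period. -/
lemma exists_trigPoly_integral_sub_le (ν : Measure ℝ) [IsFiniteMeasure ν]
    (hν : ∀ᵐ θ ∂ν, θ ∈ Set.Ioc (-Real.pi) Real.pi) {F : ℝ → ℂ} (hF : Integrable F ν)
    {ε : ℝ} (hε : 0 < ε) :
    ∃ c : ℤ →₀ ℂ, ∫ θ, ‖F θ - trigPoly c θ‖ ∂ν ≤ ε := by
  have : Fact (0 < 2 * Real.pi) := ⟨by positivity⟩
  let q : ℝ → AddCircle (2 * Real.pi) := fun x => (x : AddCircle (2 * Real.pi))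
  let j : AddCircle (2 * Real.pi) → ℝ := fun y => (AddCircle.equivIoc (2 * Real.pi) (-Real.pi) y : ℝ)
  have hq : Measurable q := AddCircle.measurable_mk'
  have hj : Measurable j :=
    measurable_subtype_coe.comp (AddCircle.measurableEquivIoc (2 * Real.pi) (-Real.pi)).measurable
  have hqj : ∀ y, q (j y) = y := fun y => AddCircle.coe_equivIoc
  have hjq : ∀ᵐ θ ∂ν, (j ∘ q) θ = id θ := by
    filter_upwards [hν] with θ hθ
    refine AddCircle.equivIoc_coe_of_mem (p := 2 * Real.pi) (a := -Real.pi) ?_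
    rwa [show -Real.pi + 2 * Real.pi = Real.pi by ring]
  have hmap : (ν.map q).map j = ν := by
    rw [Measure.map_map hj hq, Measure.map_congr hjq, Measure.map_id]
  have hFj : Integrable (F ∘ j) (ν.map q) := by
    refine Integrable.comp_measurable ?_ hj
    rwa [hmap]
  obtain ⟨g, hg, hgi⟩ := hFj.exists_boundedContinuous_integral_sub_le (half_pos hε)
  set M : ℝ := ν.real Set.univ with hM
  have hM0 : 0 ≤ M := measureReal_nonneg
  have hmem : g.toContinuousMap ∈
      (Submodule.span ℂ (Set.range (fourier (T := 2 * Real.pi)))).topologicalClosure := by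
    rw [span_fourier_closure_eq_top]; trivial
  rw [← SetLike.mem_coe, Submodule.topologicalClosure_coe, Metric.mem_closure_iff] at hmem
  obtain ⟨h, hh, hgh⟩ := hmem (ε / 2 / (M + 1)) (by positivity)
  obtain ⟨c, hc⟩ := Finsupp.mem_span_range_iff_exists_finsupp.mp hh
  refine ⟨c, ?_⟩
  have hhq : ∀ θ, h (q θ) = trigPoly c θ := by
    intro θ
    rw [trigPoly, ← hc]
    simp only [Finsupp.sum, ContinuousMap.coe_sum, Finset.sum_apply, ContinuousMap.coe_smul,
      Pi.smul_apply, smul_eq_mul, fourierChar]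
    refine Finset.sum_congr rfl fun k _ => ?_
    simp only [q, fourier_coe_apply]
    congr 2
    push_cast
    have : (Real.pi : ℂ) ≠ 0 := by exact_mod_cast Real.pi_ne_zero
    field_simp
  have hFh : Integrable (fun y => F (j y) - h y) (ν.map q) := by
    refine hFj.sub ?_
    exact (BoundedContinuousFunction.mkOfCompact h).integrable (ν.map q)
  have hFg : Integrable (fun y => ‖F (j y) - g y‖) (ν.map q) := (hFj.sub hgi).norm
  have hFt : Integrable (fun θ => ‖F θ - trigPoly c θ‖) ((ν.map q).map j) := by
    rw [integrable_map_measure _ hj.aemeasurable]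
    · refine (hFh.norm).congr (.of_forall fun y => ?_)
      simp [← hhq, hqj]
    · rw [hmap]
      exact (hF.1.sub (continuous_trigPoly c).aestronglyMeasurable).norm
  calc ∫ θ, ‖F θ - trigPoly c θ‖ ∂ν
      = ∫ θ, ‖F θ - trigPoly c θ‖ ∂((ν.map q).map j) := by rw [hmap]
    _ = ∫ y, ‖F (j y) - h y‖ ∂(ν.map q) := by
        rw [integral_map hj.aemeasurable hFt.1]
        simp [← hhq, hqj]
    _ ≤ ∫ y, (‖F (j y) - g y‖ + ε / 2 / (M + 1)) ∂(ν.map q) := by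
        refine integral_mono hFh.norm (hFg.add (integrable_const _)) fun y => ?_
        have h1 : ‖g y - h y‖ ≤ ε / 2 / (M + 1) :=
          ((ContinuousMap.dist_apply_le_dist y).trans hgh.le).trans' (by
            rw [dist_eq_norm]; rfl)
        calc ‖F (j y) - h y‖ = ‖(F (j y) - g y) + (g y - h y)‖ := by congr 1; ring
          _ ≤ _ := (norm_add_le _ _).trans (by gcongr)
    _ ≤ ε / 2 + ε / 2 := by
        rw [integral_add hFg (integrable_const _), integral_const,
          map_measureReal_apply hq MeasurableSet.univ, Set.preimage_univ, ← hM, smul_eq_mul]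
        refine add_le_add hg ?_
        rw [mul_div_assoc', div_le_iff₀ (by positivity)]
        nlinarith
    _ = ε := by ring

lemma MeasureTheory.Integrable.mul_continuous_periodMeasure {𝕜 : Type*} [RCLike 𝕜] {f φ : ℝ → 𝕜}
    (hf : Integrable f periodMeasure) (hφ : Continuous φ) :
    Integrable (fun θ => f θ * φ θ) periodMeasure := by
  have h : periodMeasure = volume.restrict (Set.Icc (-Real.pi) Real.pi) :=
    Measure.restrict_congr_set Ioc_ae_eq_Icc
  rw [h] at hf ⊢
  exact IntegrableOn.mul_continuousOn hf hφ.continuousOn isCompact_Icc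

/-- The phase `conj f / |f|` is approximated by trigonometric polynomials in `L¹(|f| dθ)`. -/
lemma exists_trigPoly_phase {f : ℝ → ℂ} (hf : Integrable f periodMeasure) {ε : ℝ} (hε : 0 < ε) :
    ∃ c : ℤ →₀ ℂ, ∫ θ, ‖(‖f θ‖ : ℂ) - f θ * trigPoly c θ‖ ∂periodMeasure ≤ ε := by
  let ν : Measure ℝ := periodMeasure.withDensity fun θ => ‖f θ‖ₑ
  have : IsFiniteMeasure ν := isFiniteMeasure_withDensity hf.2.ne
  have hac : ν ≪ periodMeasure := withDensity_absolutelyContinuous _ _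
  have hν : ∀ᵐ θ ∂ν, θ ∈ Set.Ioc (-Real.pi) Real.pi :=
    hac.ae_le (ae_restrict_mem measurableSet_Ioc)
  let F : ℝ → ℂ := fun θ => (starRingEnd ℂ) (f θ) / ‖f θ‖
  have hFm : AEStronglyMeasurable F periodMeasure := by
    have h := hf.1.aemeasurable
    refine AEMeasurable.aestronglyMeasurable ?_
    exact (Complex.continuous_conj.measurable.comp_aemeasurable h).div
      (Complex.measurable_ofReal.comp_aemeasurable h.norm)
  have hF : Integrable F ν := by
    refine Integrable.of_bound (hFm.mono_ac hac) 1 (.of_forall fun θ => ?_)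
    simp only [F, norm_div, RCLike.norm_conj, Complex.norm_real, norm_norm]
    exact div_self_le_one _
  obtain ⟨c, hc⟩ := exists_trigPoly_integral_sub_le ν hν hF hε
  refine ⟨c, le_trans (le_of_eq ?_) hc⟩
  rw [integral_withDensity_eq_integral_toReal_smul₀ hf.1.enorm (.of_forall fun θ => by simp)]
  congr 1 with θ
  rw [smul_eq_mul, toReal_enorm, ← norm_mul, mul_sub]
  have h : f θ * F θ = ‖f θ‖ := by
    by_cases h0 : f θ = 0
    · simp [h0]
    · have : (‖f θ‖ : ℂ) ≠ 0 := by simpa using h0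
      simp only [F]
      rw [mul_div_assoc', Complex.mul_conj', div_eq_iff this, sq]
  rw [h]

lemma exists_measureReal_norm_le_le {α : Type*} [MeasurableSpace α] {μ : Measure α}
    [IsFiniteMeasure μ] {f : α → ℂ} (hf : AEStronglyMeasurable f μ) (h0 : μ {x | f x = 0} = 0)
    {η : ℝ} (hη : 0 < η) : ∃ δ > 0, μ.real {x | ‖f x‖ ≤ δ} ≤ η := by
  have hanti : Antitone fun n : ℕ => {x | ‖f x‖ ≤ 1 / ((n : ℝ) + 1)} := fun m n hmn x hx =>
    show ‖f x‖ ≤ _ from le_trans hx (Nat.one_div_le_one_div hmn)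
  have h := tendsto_measure_iInter_atTop (μ := μ)
    (fun n : ℕ => nullMeasurableSet_le hf.norm.aemeasurable
      (aemeasurable_const (b := 1 / ((n : ℝ) + 1)))) hanti ⟨0, measure_ne_top _ _⟩
  have hI : ⋂ n : ℕ, {x | ‖f x‖ ≤ 1 / ((n : ℝ) + 1)} = {x | f x = 0} := by
    ext x
    simp only [Set.mem_iInter, Set.mem_ofPred_eq]
    refine ⟨fun hx => ?_, fun hx n => by rw [hx, norm_zero]; positivity⟩
    have := ge_of_tendsto' tendsto_one_div_add_atTop_nhds_zero_nat hx
    exact norm_le_zero_iff.mp this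
  rw [hI, h0] at h
  obtain ⟨n, hn⟩ := (h.eventually (gt_mem_nhds (ENNReal.ofReal_pos.mpr hη))).exists
  refine ⟨1 / ((n : ℝ) + 1), by positivity, ?_⟩
  exact ENNReal.toReal_le_of_le_ofReal hη.le hn.le

/-- The polynomial `∑ j, u j * exp (i (d + j) θ)`. -/
noncomputable def charSum {m : ℕ} (d : ℕ) (u : Fin m → ℝ) (θ : ℝ) : ℂ :=
  ∑ j, (u j : ℂ) * fourierChar (d + j) θ

lemma continuous_charSum {m : ℕ} (d : ℕ) (u : Fin m → ℝ) : Continuous (charSum d u) :=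
  continuous_finsetSum _ fun _ _ => continuous_const.mul (continuous_fourierChar _)

lemma conj_charSum {m : ℕ} (d : ℕ) (u : Fin m → ℝ) (θ : ℝ) :
    (starRingEnd ℂ) (charSum d u θ) = ∑ j, (u j : ℂ) * fourierChar (-(d + j)) θ := by
  simp [charSum, conj_fourierChar]

lemma charSum_mul_conj {m : ℕ} (d : ℕ) (u : Fin m → ℝ) (θ : ℝ) :
    charSum d u θ * (starRingEnd ℂ) (charSum d u θ) =
      ∑ i, ∑ j, ((u i * u j : ℝ) : ℂ) * fourierChar ((i : ℤ) - j) θ := by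
  rw [conj_charSum, charSum, Finset.sum_mul_sum]
  refine Finset.sum_congr rfl fun i _ => Finset.sum_congr rfl fun j _ => ?_
  rw [show ((i : ℤ) - j) = (d + i) + -(d + j) by ring,
    fourierChar_add (d + i) (-(d + j))]
  push_cast
  ring

lemma sum_norm_sq_charSum_le {m r : ℕ} (d : ℕ) {v : Fin r → EuclideanSpace ℝ (Fin m)}
    (hv : Orthonormal ℝ v) (θ : ℝ) : ∑ i, ‖charSum d (v i) θ‖ ^ 2 ≤ m := by
  let x : EuclideanSpace ℝ (Fin m) := WithLp.toLp 2 fun j => (fourierChar (d + j) θ).re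
  let y : EuclideanSpace ℝ (Fin m) := WithLp.toLp 2 fun j => (fourierChar (d + j) θ).im
  have h : ∀ u : EuclideanSpace ℝ (Fin m),
      ‖charSum d u θ‖ ^ 2 = ‖inner ℝ u x‖ ^ 2 + ‖inner ℝ u y‖ ^ 2 := by
    intro u
    rw [← Complex.normSq_eq_norm_sq, Complex.normSq_apply]
    simp [charSum, x, y, PiLp.inner_apply, sq, mul_comm]
  have hxy : ‖x‖ ^ 2 + ‖y‖ ^ 2 = m := by
    rw [EuclideanSpace.norm_sq_eq, EuclideanSpace.norm_sq_eq, ← Finset.sum_add_distrib]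
    have : ∀ j : Fin m, ‖x j‖ ^ 2 + ‖y j‖ ^ 2 = 1 := fun j => by
      have h1 := Complex.normSq_eq_norm_sq (fourierChar (d + j) θ)
      rw [norm_fourierChar, Complex.normSq_apply] at h1
      simp only [Real.norm_eq_abs, sq_abs, x, y]
      linarith
    rw [Finset.sum_congr rfl fun j _ => this j]
    simp
  simp only [h, Finset.sum_add_distrib]
  rw [← hxy]
  exact add_le_add (hv.sum_inner_products_le x) (hv.sum_inner_products_le y)

lemma integral_norm_sq_charSum {m : ℕ} (d : ℕ) (u : EuclideanSpace ℝ (Fin m)) :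
    ∫ θ, ‖charSum d u θ‖ ^ 2 ∂periodMeasure = 2 * Real.pi * ‖u‖ ^ 2 := by
  have h : ((∫ θ, ‖charSum d u θ‖ ^ 2 ∂periodMeasure : ℝ) : ℂ) =
      ((2 * Real.pi * ‖u‖ ^ 2 : ℝ) : ℂ) := by
    rw [← integral_complex_ofReal]
    simp only [Complex.ofReal_pow, ← Complex.mul_conj', charSum_mul_conj]
    have hint : ∀ i j : Fin m, Integrable
        (fun θ => ((u i * u j : ℝ) : ℂ) * fourierChar ((i : ℤ) - j) θ) periodMeasure :=
      fun i j => (continuous_const.mul (continuous_fourierChar _)).integrable_periodMeasure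
    rw [integral_finsetSum _ fun i _ => integrable_finsetSum _ fun j _ => hint i j,
      EuclideanSpace.norm_sq_eq, Finset.mul_sum, Complex.ofReal_sum]
    refine Finset.sum_congr rfl fun i _ => ?_
    rw [integral_finsetSum _ fun j _ => hint i j, Finset.sum_eq_single i]
    · rw [sub_self, integral_const_mul, integral_fourierChar_zero, Real.norm_eq_abs, sq_abs]
      push_cast
      ring
    · intro j _ hj
      rw [integral_const_mul, integral_fourierChar, mul_zero]
      rw [sub_ne_zero]
      exact fun h => hj (Fin.ext (by exact_mod_cast h.symm))
    · simp
  exact_mod_cast h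

/-- The trigonometric polynomial whose coefficients are the real parts of those of `c`. -/
noncomputable def trigPolyRe (c : ℤ →₀ ℂ) (θ : ℝ) : ℂ :=
  ∑ k ∈ c.support, ((c k).re : ℂ) * fourierChar k θ

lemma continuous_trigPolyRe (c : ℤ →₀ ℂ) : Continuous (trigPolyRe c) :=
  continuous_finsetSum _ fun k _ => continuous_const.mul (continuous_fourierChar k)

lemma norm_trigPolyRe_le (c : ℤ →₀ ℂ) (θ : ℝ) :
    ‖trigPolyRe c θ‖ ≤ ∑ k ∈ c.support, |(c k).re| := by
  refine (norm_sum_le _ _).trans_eq (Finset.sum_congr rfl fun k _ => ?_)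
  rw [norm_mul, norm_fourierChar, mul_one, Complex.norm_real, Real.norm_eq_abs]

/-- The matrix sending `u` to the coefficient vector of `U + h z ^ (n - 1) conj U`, where
`U = charSum d u` and `h = trigPolyRe c`. -/
noncomputable def reflectMatrix (n m d : ℕ) (c : ℤ →₀ ℂ) : Matrix (Fin n) (Fin m) ℝ :=
  fun s j => (if (s : ℤ) = d + j then 1 else 0) +
    ∑ k ∈ c.support, (c k).re * (if (s : ℤ) = n - 1 + k - (d + j) then 1 else 0)

lemma sum_ite_eq_mul_fourierChar {n : ℕ} {l : ℤ} (h0 : 0 ≤ l) (hn : l < n) (θ : ℝ) :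
    ∑ s : Fin n, (if (s : ℤ) = l then (1 : ℂ) else 0) * fourierChar s θ = fourierChar l θ := by
  lift l to ℕ using h0
  have hn' : l < n := by exact_mod_cast hn
  rw [Finset.sum_eq_single (⟨l, hn'⟩ : Fin n)]
  · simp
  · intro s _ hs
    rw [if_neg, zero_mul]
    exact_mod_cast fun h => hs (Fin.ext h)
  · simp

lemma charSum_reflectMatrix_mulVec {n m d : ℕ} (hn : 2 * m + 5 * d ≤ n) {c : ℤ →₀ ℂ}
    (hc : ∀ k ∈ c.support, |k| ≤ d) (u : Fin m → ℝ) (θ : ℝ) :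
    charSum 0 (reflectMatrix n m d c *ᵥ u) θ = charSum d u θ +
      trigPolyRe c θ * fourierChar (n - 1) θ * (starRingEnd ℂ) (charSum d u θ) := by
  have h : ∀ j : Fin m, ∑ s : Fin n, (reflectMatrix n m d c s j : ℂ) * fourierChar s θ =
      fourierChar (d + j) θ + trigPolyRe c θ * fourierChar (n - 1) θ * fourierChar (-(d + j)) θ := by
    intro j
    simp only [reflectMatrix, Complex.ofReal_add, Complex.ofReal_sum, Complex.ofReal_mul, add_mul,
      Finset.sum_add_distrib, Finset.sum_mul, trigPolyRe]
    have hj := j.2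
    congr 1
    · rw [← sum_ite_eq_mul_fourierChar (n := n) (l := d + j) (by omega) (by omega)]
      exact Finset.sum_congr rfl fun s _ => by split_ifs <;> simp
    · rw [Finset.sum_comm]
      refine Finset.sum_congr rfl fun k hk => ?_
      have hk' := abs_le.mp (hc k hk)
      rw [mul_assoc, mul_assoc, ← fourierChar_add, ← fourierChar_add,
        ← sum_ite_eq_mul_fourierChar (n := n) (by omega) (by omega), Finset.mul_sum]
      refine Finset.sum_congr rfl fun s _ => ?_
      rw [show k + ((n : ℤ) - 1 + -(d + j)) = n - 1 + k - (d + j) by ring]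
      split_ifs <;> simp
  rw [conj_charSum]
  simp only [charSum, Matrix.mulVec, dotProduct, Complex.ofReal_sum, Complex.ofReal_mul,
    Finset.sum_mul, Finset.mul_sum]
  rw [Finset.sum_comm, ← Finset.sum_add_distrib]
  refine Finset.sum_congr rfl fun j _ => ?_
  calc _ = (u j : ℂ) * ∑ s : Fin n, (reflectMatrix n m d c s j : ℂ) * fourierChar s θ := by
        rw [Finset.mul_sum]
        refine Finset.sum_congr rfl fun s _ => ?_
        rw [Nat.cast_zero, zero_add]
        ring
    _ = _ := by rw [h]; ring

section QuadraticForm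

variable {f : ℝ → ℂ} {a : ℤ → ℝ}

/-- The quadratic form of the Hankel matrix as an integral against its symbol. -/
lemma integral_mul_charSum_sq (hf : Integrable f periodMeasure)
    (ha : ∀ k, ∫ θ, f θ * fourierChar k θ ∂periodMeasure = 2 * Real.pi * a (-k))
    {n : ℕ} {H : Matrix (Fin n) (Fin n) ℝ} (hH : ∀ s t, H s t = a (n - 1 - s - t))
    (x : Fin n → ℝ) :
    ∫ θ, f θ * (fourierChar (-(n - 1)) θ * charSum 0 x θ ^ 2) ∂periodMeasure =
      ((2 * Real.pi * (x ⬝ᵥ H *ᵥ x) : ℝ) : ℂ) := by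
  have h : ∀ θ, f θ * (fourierChar (-(n - 1)) θ * charSum 0 x θ ^ 2) =
      ∑ s, ∑ t, ((x s * x t : ℝ) : ℂ) * (f θ * fourierChar (-(n - 1 - s - t)) θ) := by
    intro θ
    rw [sq, charSum, Finset.sum_mul_sum]
    simp only [Finset.mul_sum]
    refine Finset.sum_congr rfl fun s _ => Finset.sum_congr rfl fun t _ => ?_
    rw [show (-((n : ℤ) - 1 - s - t)) = -(n - 1) + s + t by ring,
      Nat.cast_zero, zero_add, zero_add, fourierChar_add _ (t : ℤ), fourierChar_add]
    push_cast
    ring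
  have hint : ∀ s t : Fin n, Integrable (fun θ => ((x s * x t : ℝ) : ℂ) *
      (f θ * fourierChar (-(n - 1 - s - t)) θ)) periodMeasure := fun s t =>
    (hf.mul_continuous_periodMeasure (continuous_fourierChar _)).const_mul _
  simp only [h]
  rw [integral_finsetSum _ fun s _ => integrable_finsetSum _ fun t _ => hint s t, dotProduct,
    Finset.mul_sum, Complex.ofReal_sum]
  refine Finset.sum_congr rfl fun s _ => ?_
  rw [integral_finsetSum _ fun t _ => hint s t, mulVec, dotProduct, Finset.mul_sum,
    Finset.mul_sum, Complex.ofReal_sum]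
  refine Finset.sum_congr rfl fun t _ => ?_
  rw [integral_const_mul, ha, hH, neg_neg]
  push_cast
  ring

lemma integral_mul_fourierChar_mul_norm_sq_im (hf : Integrable f periodMeasure)
    (ha : ∀ k, ∫ θ, f θ * fourierChar k θ ∂periodMeasure = 2 * Real.pi * a (-k))
    {m : ℕ} (d : ℕ) (u : Fin m → ℝ) (k : ℤ) :
    (∫ θ, f θ * (fourierChar k θ * (charSum d u θ * (starRingEnd ℂ) (charSum d u θ)))
      ∂periodMeasure).im = 0 := by
  have h : ∀ θ, f θ * (fourierChar k θ * (charSum d u θ * (starRingEnd ℂ) (charSum d u θ))) =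
      ∑ i : Fin m, ∑ j : Fin m, ((u i * u j : ℝ) : ℂ) * (f θ * fourierChar (k + (i - j)) θ) := by
    intro θ
    rw [charSum_mul_conj]
    simp only [Finset.mul_sum]
    refine Finset.sum_congr rfl fun s _ => Finset.sum_congr rfl fun t _ => ?_
    rw [fourierChar_add]
    ring
  have hint : ∀ i j : Fin m, Integrable (fun θ => ((u i * u j : ℝ) : ℂ) *
      (f θ * fourierChar (k + (i - j)) θ)) periodMeasure := fun i j =>
    (hf.mul_continuous_periodMeasure (continuous_fourierChar _)).const_mul _
  simp only [h]
  rw [integral_finsetSum _ fun i _ => integrable_finsetSum _ fun j _ => hint i j, Complex.im_sum]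
  refine Finset.sum_eq_zero fun i _ => ?_
  rw [integral_finsetSum _ fun j _ => hint i j, Complex.im_sum]
  refine Finset.sum_eq_zero fun j _ => ?_
  rw [integral_const_mul, ha, Complex.im_ofReal_mul]
  simp

/-- For real Fourier coefficients, only the real parts of the coefficients of `c` contribute. -/
lemma re_integral_mul_trigPoly (hf : Integrable f periodMeasure)
    (ha : ∀ k, ∫ θ, f θ * fourierChar k θ ∂periodMeasure = 2 * Real.pi * a (-k))
    {m : ℕ} (d : ℕ) (u : Fin m → ℝ) (c : ℤ →₀ ℂ) :
    (∫ θ, f θ * (trigPoly c θ * (charSum d u θ * (starRingEnd ℂ) (charSum d u θ)))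
      ∂periodMeasure).re =
    (∫ θ, f θ * (trigPolyRe c θ * (charSum d u θ * (starRingEnd ℂ) (charSum d u θ)))
      ∂periodMeasure).re := by
  have hint : ∀ (z : ℂ) (k : ℤ), Integrable (fun θ => z * (f θ * (fourierChar k θ *
      (charSum d u θ * (starRingEnd ℂ) (charSum d u θ))))) periodMeasure := fun z k =>
    (hf.mul_continuous_periodMeasure ((continuous_fourierChar k).mul ((continuous_charSum d u).mul
      (Complex.continuous_conj.comp (continuous_charSum d u))))).const_mul z
  have key : ∀ b : ℤ → ℂ, (∫ θ, f θ * ((∑ k ∈ c.support, b k * fourierChar k θ) *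
      (charSum d u θ * (starRingEnd ℂ) (charSum d u θ))) ∂periodMeasure).re =
      ∑ k ∈ c.support, (b k).re * (∫ θ, f θ * (fourierChar k θ *
        (charSum d u θ * (starRingEnd ℂ) (charSum d u θ))) ∂periodMeasure).re := by
    intro b
    have h : ∀ θ, f θ * ((∑ k ∈ c.support, b k * fourierChar k θ) *
        (charSum d u θ * (starRingEnd ℂ) (charSum d u θ))) = ∑ k ∈ c.support, b k * (f θ *
          (fourierChar k θ * (charSum d u θ * (starRingEnd ℂ) (charSum d u θ)))) := by
      intro θ
      rw [Finset.sum_mul, Finset.mul_sum]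
      exact Finset.sum_congr rfl fun k _ => by ring
    simp only [h]
    rw [integral_finsetSum _ fun k _ => hint (b k) k, Complex.re_sum]
    refine Finset.sum_congr rfl fun k _ => ?_
    rw [integral_const_mul, Complex.mul_re, integral_mul_fourierChar_mul_norm_sq_im hf ha]
    ring
  simp only [trigPoly, trigPolyRe, Finsupp.sum]
  rw [key, key fun k => ((c k).re : ℂ)]
  simp

end QuadraticForm

lemma integral_trigPoly_mul_sq {ι : Type*} {d : ℕ} {p : ℤ →₀ ℂ} (hp : ∀ k ∈ p.support, |k| ≤ d)
    (S : Finset ι) (b : ι → ℂ) (l : ι → ℤ) (q : ℤ)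
    (hl : ∀ i ∈ S, ∀ j ∈ S, (d : ℤ) < |q + l i + l j|) :
    ∫ θ, trigPoly p θ * (fourierChar q θ * (∑ i ∈ S, b i * fourierChar (l i) θ) ^ 2)
      ∂periodMeasure = 0 := by
  have hint : ∀ i j, Integrable (fun θ => (b i * b j) *
      (trigPoly p θ * fourierChar (q + l i + l j) θ)) periodMeasure := fun i j =>
    (continuous_const.mul
      ((continuous_trigPoly p).mul (continuous_fourierChar _))).integrable_periodMeasure
  have h : ∀ θ, trigPoly p θ * (fourierChar q θ * (∑ i ∈ S, b i * fourierChar (l i) θ) ^ 2) =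
      ∑ i ∈ S, ∑ j ∈ S, (b i * b j) * (trigPoly p θ * fourierChar (q + l i + l j) θ) := by
    intro θ
    rw [sq, Finset.sum_mul_sum]
    simp only [Finset.mul_sum, fourierChar_add]
    exact Finset.sum_congr rfl fun i _ => Finset.sum_congr rfl fun j _ => by ring
  simp only [h]
  rw [integral_finsetSum _ fun i _ => integrable_finsetSum _ fun j _ => hint i j]
  refine Finset.sum_eq_zero fun i hi => ?_
  rw [integral_finsetSum _ fun j _ => hint i j]
  refine Finset.sum_eq_zero fun j hj => ?_
  rw [integral_const_mul, integral_trigPoly_mul_fourierChar hp (hl i hi j hj), mul_zero]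

/-- Trigonometric polynomials of low degree annihilate the corner terms of the squares of the
reflected vectors. -/
lemma integral_trigPoly_mul_corner {n m d : ℕ} (hn : 2 * m + 5 * d ≤ n) {c p : ℤ →₀ ℂ}
    (hc : ∀ k ∈ c.support, |k| ≤ d) (hp : ∀ k ∈ p.support, |k| ≤ d) (u : Fin m → ℝ) :
    ∫ θ, trigPoly p θ * (fourierChar (-(n - 1)) θ * charSum d u θ ^ 2 + fourierChar (n - 1) θ *
      (trigPolyRe c θ * (starRingEnd ℂ) (charSum d u θ)) ^ 2) ∂periodMeasure = 0 := by
  have hU := continuous_charSum d u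
  have hV : ∀ θ, trigPolyRe c θ * (starRingEnd ℂ) (charSum d u θ) =
      ∑ x ∈ c.support ×ˢ (Finset.univ : Finset (Fin m)),
        (((c x.1).re : ℂ) * u x.2) * fourierChar (x.1 + -(d + x.2)) θ := by
    intro θ
    rw [conj_charSum, trigPolyRe, Finset.sum_mul_sum, Finset.sum_product]
    simp only [fourierChar_add]
    exact Finset.sum_congr rfl fun i _ => Finset.sum_congr rfl fun j _ => by ring
  simp only [mul_add]
  rw [integral_add]
  · simp only [hV]
    rw [integral_trigPoly_mul_sq hp, add_zero]
    · refine integral_trigPoly_mul_sq hp Finset.univ (fun j => (u j : ℂ)) _ _ fun i _ j _ => ?_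
      have hi := i.2
      have hj := j.2
      exact lt_abs.mpr (.inr (by omega))
    · intro i hi j hj
      rw [Finset.mem_product] at hi hj
      have hi' := abs_le.mp (hc _ hi.1)
      have hj' := abs_le.mp (hc _ hj.1)
      have hi2 := i.2.2
      have hj2 := j.2.2
      exact lt_abs.mpr (.inl (by omega))
  · exact ((continuous_trigPoly p).mul
      ((continuous_fourierChar _).mul (hU.pow 2))).integrable_periodMeasure
  · exact ((continuous_trigPoly p).mul ((continuous_fourierChar _).mul
      (((continuous_trigPolyRe c).mul
        (Complex.continuous_conj.comp hU)).pow 2))).integrable_periodMeasure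

lemma integrable_phase_error {f : ℝ → ℂ} (hf : Integrable f periodMeasure) (c : ℤ →₀ ℂ) :
    Integrable (fun θ => ‖(‖f θ‖ : ℂ) - f θ * trigPoly c θ‖) periodMeasure :=
  (hf.norm.ofReal.sub (hf.mul_continuous_periodMeasure (continuous_trigPoly c))).norm

lemma integrable_norm_sub_trigPoly {f : ℝ → ℂ} (hf : Integrable f periodMeasure) (p : ℤ →₀ ℂ) :
    Integrable (fun θ => ‖f θ - trigPoly p θ‖) periodMeasure :=
  (hf.sub (continuous_trigPoly p).integrable_periodMeasure).norm

lemma integrable_gap {f : ℝ → ℂ} (hf : Integrable f periodMeasure) (c p : ℤ →₀ ℂ) (C : ℝ) :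
    Integrable (fun θ => 2 * ‖f θ‖ - 2 * ‖(‖f θ‖ : ℂ) - f θ * trigPoly c θ‖ -
      C * ‖f θ - trigPoly p θ‖) periodMeasure :=
  ((hf.norm.const_mul 2).sub ((integrable_phase_error hf c).const_mul 2)).sub
    ((integrable_norm_sub_trigPoly hf p).const_mul C)

/-- Lower bound for the quadratic form on reflected vectors. -/
lemma integral_le_quadraticForm {f : ℝ → ℂ} {a : ℤ → ℝ} (hf : Integrable f periodMeasure)
    (ha : ∀ k, ∫ θ, f θ * fourierChar k θ ∂periodMeasure = 2 * Real.pi * a (-k))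
    {n : ℕ} {H : Matrix (Fin n) (Fin n) ℝ} (hH : ∀ s t, H s t = a (n - 1 - s - t))
    {m d : ℕ} (hn : 2 * m + 5 * d ≤ n) {c p : ℤ →₀ ℂ} (hc : ∀ k ∈ c.support, |k| ≤ d)
    (hp : ∀ k ∈ p.support, |k| ≤ d) {B : ℝ} (hB : ∀ θ, ‖trigPolyRe c θ‖ ≤ B) (u : Fin m → ℝ) :
    ∫ θ, (2 * ‖f θ‖ - 2 * ‖(‖f θ‖ : ℂ) - f θ * trigPoly c θ‖ -
        (1 + B ^ 2) * ‖f θ - trigPoly p θ‖) * ‖charSum d u θ‖ ^ 2 ∂periodMeasure ≤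
      2 * Real.pi *
        ((reflectMatrix n m d c *ᵥ u) ⬝ᵥ H *ᵥ (reflectMatrix n m d c *ᵥ u)) := by
  set x := reflectMatrix n m d c *ᵥ u
  set U : ℝ → ℂ := charSum d u with hUdef
  set h := trigPolyRe c with hh
  have hU : Continuous U := continuous_charSum d u
  have hU' : Continuous fun θ => (starRingEnd ℂ) (U θ) := Complex.continuous_conj.comp hU
  have hhc : Continuous h := continuous_trigPolyRe c
  let K : ℝ → ℂ := fun θ => fourierChar (-(n - 1)) θ * U θ ^ 2 +
    fourierChar (n - 1) θ * (h θ * (starRingEnd ℂ) (U θ)) ^ 2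
  have hK : Continuous K := ((continuous_fourierChar _).mul (hU.pow 2)).add
    ((continuous_fourierChar _).mul ((hhc.mul hU').pow 2))
  have hKb : ∀ θ, ‖K θ‖ ≤ (1 + B ^ 2) * ‖U θ‖ ^ 2 := fun θ => by
    refine (norm_add_le _ _).trans ?_
    simp only [norm_mul, norm_pow, norm_fourierChar, RCLike.norm_conj, one_mul]
    rw [add_mul, one_mul, mul_pow]
    gcongr
    exact hB θ
  let W : ℝ → ℂ := fun θ => U θ * (starRingEnd ℂ) (U θ)
  have hW : Continuous W := hU.mul hU'
  have hWn : ∀ θ, W θ = ((‖U θ‖ ^ 2 : ℝ) : ℂ) := fun θ => by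
    simp only [W]
    rw [Complex.mul_conj']
    push_cast
    rfl
  have hfK : Integrable (fun θ => f θ * K θ) periodMeasure :=
    hf.mul_continuous_periodMeasure hK
  have hpK : Integrable (fun θ => trigPoly p θ * K θ) periodMeasure :=
    ((continuous_trigPoly p).mul hK).integrable_periodMeasure
  have hfh : Integrable (fun θ => f θ * (h θ * W θ)) periodMeasure :=
    hf.mul_continuous_periodMeasure (hhc.mul hW)
  have hfc : Integrable (fun θ => f θ * (trigPoly c θ * W θ)) periodMeasure :=
    hf.mul_continuous_periodMeasure ((continuous_trigPoly c).mul hW)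
  have hgK : Integrable (fun θ => (f θ - trigPoly p θ) * K θ) periodMeasure := by
    refine (hfK.sub hpK).congr (.of_forall fun θ => ?_)
    simp [sub_mul]
  have hgKre : Integrable (fun θ => ((f θ - trigPoly p θ) * K θ).re) periodMeasure := hgK.re
  have hfcre : Integrable (fun θ => (f θ * (trigPoly c θ * W θ)).re) periodMeasure := hfc.re
  have hQ : 2 * Real.pi * (x ⬝ᵥ H *ᵥ x) = ∫ θ, ((f θ - trigPoly p θ) * K θ).re +
      2 * (f θ * (trigPoly c θ * W θ)).re ∂periodMeasure := by
    have h1 := integral_mul_charSum_sq hf ha hH x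
    have h2 : ∀ θ, f θ * (fourierChar (-(n - 1)) θ * charSum 0 x θ ^ 2) =
        f θ * K θ + 2 * (f θ * (h θ * W θ)) := by
      intro θ
      rw [charSum_reflectMatrix_mulVec hn hc]
      have h3 : fourierChar (-((n : ℤ) - 1)) θ * fourierChar (n - 1) θ = 1 := by
        rw [← fourierChar_add]; simp [fourierChar]
      simp only [K, W, ← hUdef, ← hh]
      linear_combination (f θ * h θ * U θ * (starRingEnd ℂ) (U θ) * 2 +
        f θ * fourierChar (n - 1) θ * h θ ^ 2 * (starRingEnd ℂ) (U θ) ^ 2) * h3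
    have h4 : ∫ θ, trigPoly p θ * K θ ∂periodMeasure = 0 :=
      integral_trigPoly_mul_corner hn hc hp u
    have h5 : ∫ θ, f θ * K θ ∂periodMeasure =
        ∫ θ, (f θ - trigPoly p θ) * K θ ∂periodMeasure := by
      simp only [sub_mul]
      rw [integral_sub hfK hpK, h4, sub_zero]
    simp only [h2] at h1
    rw [integral_add hfK (hfh.const_mul 2), integral_const_mul, h5] at h1
    have h6 := congrArg Complex.re h1
    rw [Complex.ofReal_re] at h6
    have hre : ∀ {g : ℝ → ℂ}, Integrable g periodMeasure →
        ∫ θ, (g θ).re ∂periodMeasure = (∫ θ, g θ ∂periodMeasure).re := fun hg => integral_re hg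
    rw [← h6, integral_add hgKre (hfcre.const_mul 2), integral_const_mul, hre hgK, hre hfc,
      re_integral_mul_trigPoly hf ha]
    simp [W, hUdef, hh]
  rw [hQ]
  refine integral_mono ?_ (hgKre.add (hfcre.const_mul 2)) fun θ => ?_
  · exact (integrable_gap hf c p _).mul_continuous_periodMeasure (hU.norm.pow 2)
  · have e1 : -((1 + B ^ 2) * ‖f θ - trigPoly p θ‖ * ‖U θ‖ ^ 2) ≤
        ((f θ - trigPoly p θ) * K θ).re := by
      refine le_trans (neg_le_neg ?_) (neg_le_of_abs_le (Complex.abs_re_le_norm _))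
      rw [norm_mul]
      calc _ ≤ ‖f θ - trigPoly p θ‖ * ((1 + B ^ 2) * ‖U θ‖ ^ 2) := by gcongr; exact hKb θ
        _ = _ := by ring
    have e2 : (‖f θ‖ - ‖(‖f θ‖ : ℂ) - f θ * trigPoly c θ‖) * ‖U θ‖ ^ 2 ≤
        (f θ * (trigPoly c θ * W θ)).re := by
      rw [hWn, ← mul_assoc, Complex.re_mul_ofReal]
      gcongr
      have := Complex.re_le_norm ((‖f θ‖ : ℂ) - f θ * trigPoly c θ)
      rw [Complex.sub_re, Complex.ofReal_re] at this
      linarith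
    dsimp only
    linarith

/-- A subspace on which the quadratic form is nonpositive along the reflected vectors has dimension
at most a small multiple of `m`. -/
lemma card_le_of_quadraticForm_nonpos {f : ℝ → ℂ} {a : ℤ → ℝ} (hf : Integrable f periodMeasure)
    (ha : ∀ k, ∫ θ, f θ * fourierChar k θ ∂periodMeasure = 2 * Real.pi * a (-k))
    {n : ℕ} {H : Matrix (Fin n) (Fin n) ℝ} (hH : ∀ s t, H s t = a (n - 1 - s - t))
    {m d : ℕ} (hn : 2 * m + 5 * d ≤ n) {c p : ℤ →₀ ℂ} (hc : ∀ k ∈ c.support, |k| ≤ d)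
    (hp : ∀ k ∈ p.support, |k| ≤ d) {B : ℝ} (hB : ∀ θ, ‖trigPolyRe c θ‖ ≤ B) {δ η : ℝ} (hδ : 0 < δ)
    (hfδ : periodMeasure.real {θ | ‖f θ‖ ≤ δ} ≤ η)
    (hcη : ∫ θ, ‖(‖f θ‖ : ℂ) - f θ * trigPoly c θ‖ ∂periodMeasure ≤ δ * η)
    (hpη : (1 + B ^ 2) * ∫ θ, ‖f θ - trigPoly p θ‖ ∂periodMeasure ≤ δ * η)
    {r : ℕ} {v : Fin r → EuclideanSpace ℝ (Fin m)} (hv : Orthonormal ℝ v)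
    (hneg : ∀ i, (reflectMatrix n m d c *ᵥ v i) ⬝ᵥ H *ᵥ (reflectMatrix n m d c *ᵥ v i) ≤ 0) :
    (r : ℝ) ≤ m * η := by
  set G : ℝ → ℝ := fun θ => 2 * ‖f θ‖ - 2 * ‖(‖f θ‖ : ℂ) - f θ * trigPoly c θ‖ -
    (1 + B ^ 2) * ‖f θ - trigPoly p θ‖ with hG
  have hGi : Integrable G periodMeasure := integrable_gap hf c p _
  set w : ℝ → ℝ := fun θ => ∑ i, ‖charSum d (v i) θ‖ ^ 2 with hw
  have hwc : ∀ i, Continuous fun θ => ‖charSum d (v i) θ‖ ^ 2 := fun i =>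
    (continuous_charSum d (v i)).norm.pow 2
  have hwi : Integrable w periodMeasure :=
    (continuous_finsetSum _ fun i _ => hwc i).integrable_periodMeasure
  have hGw : Integrable (fun θ => G θ * w θ) periodMeasure :=
    hGi.mul_continuous_periodMeasure (continuous_finsetSum _ fun i _ => hwc i)
  have hw0 : ∀ θ, 0 ≤ w θ := fun θ => Finset.sum_nonneg fun i _ => by positivity
  have hwm : ∀ θ, w θ ≤ m := fun θ => sum_norm_sq_charSum_le d hv θ
  have hwint : ∫ θ, w θ ∂periodMeasure = 2 * Real.pi * r := by
    rw [integral_finsetSum _ fun i _ => (hwc i).integrable_periodMeasure]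
    simp [integral_norm_sq_charSum, hv.1, mul_comm]
  have hle : ∫ θ, G θ * w θ ∂periodMeasure ≤ 0 := by
    simp only [hw, Finset.mul_sum]
    rw [integral_finsetSum _ fun i _ => hGi.mul_continuous_periodMeasure (hwc i)]
    refine Finset.sum_nonpos fun i _ => ?_
    refine (integral_le_quadraticForm hf ha hH hn hc hp hB (v i)).trans ?_
    exact mul_nonpos_of_nonneg_of_nonpos (by positivity) (hneg i)
  have hnull : NullMeasurableSet {θ | ‖f θ‖ ≤ δ} periodMeasure :=
    nullMeasurableSet_le hf.1.norm.aemeasurable aemeasurable_const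
  set χ : ℝ → ℝ := Set.indicator {θ | ‖f θ‖ ≤ δ} 1 with hχ
  have hχi : Integrable χ periodMeasure :=
    (integrable_const (1 : ℝ)).indicator₀ hnull
  have hχint : ∫ θ, χ θ ∂periodMeasure ≤ η := by
    rw [hχ, integral_indicator₀ hnull]
    simpa using hfδ
  have hE := integrable_phase_error hf c
  have hP := integrable_norm_sub_trigPoly hf p
  have i₂ : Integrable (fun θ => 2 * δ * w θ - 2 * δ * m * χ θ) periodMeasure :=
    (hwi.const_mul _).sub (hχi.const_mul _)
  have i₃ : Integrable (fun θ => 2 * δ * w θ - 2 * δ * m * χ θ -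
      2 * m * ‖(‖f θ‖ : ℂ) - f θ * trigPoly c θ‖) periodMeasure :=
    i₂.sub (hE.const_mul _)
  have hlow : ∫ θ, (2 * δ * w θ - 2 * δ * m * χ θ - 2 * m * ‖(‖f θ‖ : ℂ) - f θ * trigPoly c θ‖ -
      m * ((1 + B ^ 2) * ‖f θ - trigPoly p θ‖)) ∂periodMeasure ≤ 0 := by
    refine (integral_mono ?_ hGw fun θ => ?_).trans hle
    · exact i₃.sub ((hP.const_mul _).const_mul _)
    · have h1 : δ * w θ - δ * m * χ θ ≤ ‖f θ‖ * w θ := by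
        by_cases h : ‖f θ‖ ≤ δ
        · have : χ θ = 1 := Set.indicator_of_mem (by exact h) _
          rw [this]
          nlinarith [norm_nonneg (f θ), hw0 θ, hwm θ]
        · have : χ θ = 0 := Set.indicator_of_notMem (by exact h) _
          rw [this]
          nlinarith [hw0 θ]
      have h2 := mul_le_mul_of_nonneg_left (hwm θ) (norm_nonneg ((‖f θ‖ : ℂ) - f θ * trigPoly c θ))
      have h3 := mul_le_mul_of_nonneg_left (hwm θ)
        (show 0 ≤ (1 + B ^ 2) * ‖f θ - trigPoly p θ‖ by positivity)
      simp only [hG]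
      linarith
  rw [integral_sub i₃ ((hP.const_mul _).const_mul _), integral_sub i₂ (hE.const_mul _),
    integral_sub (hwi.const_mul _) (hχi.const_mul _)] at hlow
  simp only [integral_const_mul] at hlow
  rw [hwint] at hlow
  have hm : (0 : ℝ) ≤ m := Nat.cast_nonneg m
  have k1 := mul_le_mul_of_nonneg_left hχint (mul_nonneg hδ.le hm)
  have k2 := mul_le_mul_of_nonneg_left hcη hm
  have k3 := mul_le_mul_of_nonneg_left hpη hm
  have k4 : δ * (4 * Real.pi * r) ≤ δ * (5 * (m * η)) := by linarith
  have k5 := le_of_mul_le_mul_left k4 hδ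
  nlinarith [Real.pi_gt_three, (Nat.cast_nonneg r : (0 : ℝ) ≤ r)]

lemma exists_abs_le_support (c p : ℤ →₀ ℂ) :
    ∃ d : ℕ, (∀ k ∈ c.support, |k| ≤ d) ∧ ∀ k ∈ p.support, |k| ≤ d := by
  refine ⟨(c.support ∪ p.support).sup Int.natAbs, fun k hk => ?_, fun k hk => ?_⟩ <;>
  · rw [Int.abs_eq_natAbs]
    exact_mod_cast Finset.le_sup (f := Int.natAbs) (by simp_all)

/-- If the Hankel quadratic form is nonpositive on the common kernel of finitely many linear forms,
then there are at least about `n / 2` forms. -/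
lemma exists_le_card_of_nonpos_on_ker {f : ℝ → ℂ} {a : ℤ → ℝ} (hf : Integrable f periodMeasure)
    (hsv : periodMeasure {θ | f θ = 0} = 0)
    (ha : ∀ k, ∫ θ, f θ * fourierChar k θ ∂periodMeasure = 2 * Real.pi * a (-k))
    {η : ℝ} (hη : 0 < η) :
    ∃ C : ℝ, ∀ (n : ℕ) (H : Matrix (Fin n) (Fin n) ℝ), (∀ s t, H s t = a (n - 1 - s - t)) →
      ∀ S : Finset (Fin n), ∀ ψ : Fin n → (Fin n → ℝ) →ₗ[ℝ] ℝ,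
      (∀ x, (∀ i ∈ S, ψ i x = 0) → x ⬝ᵥ H *ᵥ x ≤ 0) → (n : ℝ) / 2 - C - n * η ≤ S.card := by
  obtain ⟨δ, hδ, hfδ⟩ := exists_measureReal_norm_le_le hf.1 hsv hη
  obtain ⟨c, hcη⟩ := exists_trigPoly_phase hf (mul_pos hδ hη)
  set B : ℝ := ∑ k ∈ c.support, |(c k).re| with hB
  obtain ⟨p, hp⟩ := exists_trigPoly_integral_sub_le periodMeasure
    (ae_restrict_mem measurableSet_Ioc) hf (show 0 < δ * η / (1 + B ^ 2) by positivity)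
  have hpη : (1 + B ^ 2) * ∫ θ, ‖f θ - trigPoly p θ‖ ∂periodMeasure ≤ δ * η := by
    rw [le_div_iff₀ (by positivity)] at hp
    linarith
  obtain ⟨d, hcd, hpd⟩ := exists_abs_le_support c p
  refine ⟨(5 * d + 1) / 2, fun n H hH S ψ hψ => ?_⟩
  rcases lt_or_ge n (5 * d) with hnd | hnd
  · have : (n : ℝ) < 5 * d := by exact_mod_cast hnd
    have h1 : (0 : ℝ) ≤ n * η := by positivity
    have h2 : (0 : ℝ) ≤ S.card := Nat.cast_nonneg _
    linarith
  obtain ⟨m, hm⟩ : ∃ m, m = (n - 5 * d) / 2 := ⟨_, rfl⟩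
  have hn : 2 * m + 5 * d ≤ n := by omega
  have hn' : n ≤ 2 * m + 5 * d + 1 := by omega
  let Φ : EuclideanSpace ℝ (Fin m) →ₗ[ℝ] (S → ℝ) := LinearMap.pi fun i =>
    ψ i ∘ₗ (reflectMatrix n m d c).mulVecLin ∘ₗ (WithLp.linearEquiv 2 ℝ (Fin m → ℝ)).toLinearMap
  have hdim : m ≤ S.card + Module.finrank ℝ (LinearMap.ker Φ) := by
    have h1 := Φ.finrank_range_add_finrank_ker
    have h2 := Submodule.finrank_le (LinearMap.range Φ)
    rw [Module.finrank_fintype_fun_eq_card, Fintype.card_coe] at h2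
    rw [finrank_euclideanSpace_fin] at h1
    omega
  let b := stdOrthonormalBasis ℝ (LinearMap.ker Φ)
  have hv : Orthonormal ℝ fun i => (b i : EuclideanSpace ℝ (Fin m)) :=
    b.orthonormal.comp_linearIsometry (LinearMap.ker Φ).subtypeₗᵢ
  have hr := card_le_of_quadraticForm_nonpos hf ha hH hn hcd hpd (norm_trigPolyRe_le c) hδ hfδ hcη
    hpη hv fun i => hψ _ fun j hj => by
      have h : Φ (b i) = 0 := LinearMap.mem_ker.mp (b i).2
      exact congrFun h ⟨j, hj⟩
  have h1 : (m : ℝ) ≤ S.card + Module.finrank ℝ (LinearMap.ker Φ) := by exact_mod_cast hdim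
  have h2 : (n : ℝ) ≤ 2 * m + 5 * d + 1 := by exact_mod_cast hn'
  have h3 : (m : ℝ) ≤ n := by exact_mod_cast (by omega : m ≤ n)
  have h4 := mul_le_mul_of_nonneg_right h3 hη.le
  linarith

lemma Matrix.IsHermitian.dotProduct_mulVec_eq_sum {n : ℕ} {A : Matrix (Fin n) (Fin n) ℝ}
    (hA : A.IsHermitian) (x : Fin n → ℝ) :
    x ⬝ᵥ A *ᵥ x = ∑ i, hA.eigenvalues i * ((hA.eigenvectorBasis i).ofLp ⬝ᵥ x) ^ 2 := by
  have h := hA.eigenvectorBasis.sum_inner_mul_inner (WithLp.toLp 2 x) (WithLp.toLp 2 (A *ᵥ x))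
  have hin : ∀ y z : EuclideanSpace ℝ (Fin n), inner ℝ y z = y.ofLp ⬝ᵥ z.ofLp := fun y z => by
    simp [PiLp.inner_apply, dotProduct, mul_comm]
  simp only [hin] at h
  rw [← h]
  refine Finset.sum_congr rfl fun i _ => ?_
  have hT : Aᵀ = A := by simpa [Matrix.IsHermitian, conjTranspose] using hA
  rw [dotProduct_mulVec, ← mulVec_transpose, hT, hA.mulVec_eigenvectorBasis, smul_dotProduct,
    dotProduct_comm x, smul_eq_mul]
  ring

/-- If `f ∈ L¹([-π,π])` has real Fourier coefficients and is sparsely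
vanishing (its zero set is Lebesgue-null), then the flipped Toeplitz matrices
`Y n * T n` are real symmetric and the difference between the numbers of positive and
negative eigenvalues is `o(n)`. -/
theorem flipped_toeplitz_inertia_o_n
    (f : ℝ → ℂ) (hf : IntegrableOn f (Set.Icc (-Real.pi) Real.pi))
    (hsv : volume {θ ∈ Set.Icc (-Real.pi) Real.pi | f θ = 0} = 0)
    (a : ℤ → ℝ)
    (ha : ∀ k : ℤ, (a k : ℂ) =
      (1 / (2 * Real.pi) : ℂ) * ∫ θ in (-Real.pi)..Real.pi, f θ * Complex.exp (-Complex.I * k * θ))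
    (T : (n : ℕ) → Matrix (Fin n) (Fin n) ℝ)
    (hT : ∀ n, ∀ s t : Fin n, T n s t = a ((s : ℤ) - (t : ℤ)))
    (Y : (n : ℕ) → Matrix (Fin n) (Fin n) ℝ)
    (hY : ∀ n, ∀ s t : Fin n, Y n s t = if (s : ℕ) + (t : ℕ) + 1 = n then 1 else 0) :
    ∃ hsym : ∀ n, (Y n * T n).IsHermitian,
      Tendsto (fun n : ℕ =>
        |((Finset.univ.filter fun i : Fin n => 0 < (hsym n).eigenvalues i).card : ℝ) -
          ((Finset.univ.filter fun i : Fin n => (hsym n).eigenvalues i < 0).card : ℝ)| / n)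
        atTop (nhds 0) := by
  have hpi : (Real.pi : ℂ) ≠ 0 := by exact_mod_cast Real.pi_ne_zero
  have hfi : Integrable f periodMeasure := hf.mono_set Set.Ioc_subset_Icc_self
  have hsv' : periodMeasure {θ | f θ = 0} = 0 := by
    rw [Measure.restrict_apply₀' measurableSet_Ioc.nullMeasurableSet]
    refine measure_mono_null ?_ hsv
    rintro θ ⟨h0, hθ⟩
    exact ⟨Set.Ioc_subset_Icc_self hθ, h0⟩
  have hcoef : ∀ k, ∫ θ, f θ * fourierChar k θ ∂periodMeasure = 2 * Real.pi * a (-k) := by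
    intro k
    rw [ha, intervalIntegral.integral_of_le (by linarith [Real.pi_pos]), ← mul_assoc,
      mul_one_div_cancel (mul_ne_zero two_ne_zero hpi), one_mul]
    simp [fourierChar]
  have hcoef' : ∀ k, ∫ θ, -f θ * fourierChar k θ ∂periodMeasure =
      2 * Real.pi * ((-a (-k) : ℝ) : ℂ) := by
    intro k
    simp only [neg_mul, integral_neg, hcoef]
    push_cast
    ring
  have hH : ∀ n, ∀ s t : Fin n, (Y n * T n) s t = a (n - 1 - s - t) := by
    intro n s t
    rw [mul_apply, Finset.sum_eq_single s.rev]
    · rw [hY, if_pos (by rw [Fin.val_rev]; omega), one_mul, hT, Fin.val_rev]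
      congr 1
      have := s.2
      omega
    · intro i _ hi
      rw [hY, if_neg, zero_mul]
      exact fun h => hi (Fin.ext (by rw [Fin.val_rev]; omega))
    · simp
  have hsym : ∀ n, (Y n * T n).IsHermitian := by
    intro n
    ext s t
    rw [conjTranspose_apply, star_trivial, hH, hH]
    congr 1
    ring
  refine ⟨hsym, ?_⟩
  rw [Metric.tendsto_atTop]
  intro ε hε
  obtain ⟨C₁, hC₁⟩ := exists_le_card_of_nonpos_on_ker hfi hsv' hcoef (show 0 < ε / 4 by positivity)
  obtain ⟨C₂, hC₂⟩ := exists_le_card_of_nonpos_on_ker (f := fun θ => -f θ) (a := fun k => -a k)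
    hfi.neg (by simpa using hsv') hcoef' (show 0 < ε / 4 by positivity)
  obtain ⟨N, hN⟩ := exists_nat_gt (4 * max C₁ C₂ / ε)
  refine ⟨N + 1, fun n hn => ?_⟩
  have hn0 : (0 : ℝ) < n := by exact_mod_cast (by omega : 0 < n)
  have hCn : 4 * max C₁ C₂ < n * ε := by
    rw [div_lt_iff₀ hε] at hN
    refine hN.trans_le ?_
    gcongr
    omega
  let ψ : Fin n → (Fin n → ℝ) →ₗ[ℝ] ℝ := fun i =>
    dotProductBilin ℝ ℝ ((hsym n).eigenvectorBasis i).ofLp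
  have hP := hC₁ n (Y n * T n) (hH n) (Finset.univ.filter fun i => 0 < (hsym n).eigenvalues i) ψ
    fun x hx => by
      rw [(hsym n).dotProduct_mulVec_eq_sum]
      refine Finset.sum_nonpos fun i _ => ?_
      by_cases hi : 0 < (hsym n).eigenvalues i
      · have : ((hsym n).eigenvectorBasis i).ofLp ⬝ᵥ x = 0 := hx i (by simpa using hi)
        simp [this]
      · exact mul_nonpos_of_nonpos_of_nonneg (not_lt.mp hi) (sq_nonneg _)
  have hQ := hC₂ n (-(Y n * T n)) (fun s t => by rw [Matrix.neg_apply, hH])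
    (Finset.univ.filter fun i => (hsym n).eigenvalues i < 0) ψ fun x hx => by
      rw [neg_mulVec, dotProduct_neg, neg_nonpos, (hsym n).dotProduct_mulVec_eq_sum]
      refine Finset.sum_nonneg fun i _ => ?_
      by_cases hi : (hsym n).eigenvalues i < 0
      · have : ((hsym n).eigenvectorBasis i).ofLp ⬝ᵥ x = 0 := hx i (by simpa using hi)
        simp [this]
      · exact mul_nonneg (not_lt.mp hi) (sq_nonneg _)
  have hsum : (Finset.univ.filter fun i => 0 < (hsym n).eigenvalues i).card +
      (Finset.univ.filter fun i => (hsym n).eigenvalues i < 0).card ≤ n := by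
    rw [← Finset.card_union_of_disjoint]
    · exact (Finset.card_le_univ _).trans_eq (Fintype.card_fin n)
    · exact Finset.disjoint_filter.mpr fun i _ h1 h2 => lt_asymm h1 h2
  have hsum' : ((Finset.univ.filter fun i => 0 < (hsym n).eigenvalues i).card : ℝ) +
      (Finset.univ.filter fun i => (hsym n).eigenvalues i < 0).card ≤ n := by exact_mod_cast hsum
  rw [Real.dist_eq, sub_zero, abs_div, abs_abs, Nat.abs_cast, div_lt_iff₀ hn0, abs_lt]
  have := le_max_left C₁ C₂
  have := le_max_right C₁ C₂
  constructor <;> linarith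
end
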